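/- Let R be a Cohen-Macaulay local ring of dimension d > 1 with maximal ideal m, and let C be a semidualizing R-module with id_{R_p}(C_p) < ∞ for all primes p ≠ m. Let M be a generalized Cohen-Macaulay finitely generated R-module in the Bass class B_C which is horizontally linked with respect to C. Then Ext^i_R(Hom_R(C,M), C) ≅ H^i_m(λ_R(C,M)) for all i with 0 < i < d. In particular, λ_R(C,M) is generalized Cohen-Macaulay. -/

import Mathlib

/- Preliminary definitions for formalizing
   "Linkage of modules with respect to a semidualizing module"
   (Dibaei–Sadeghi). -/

open CategoryTheory

universe u
noncomputable section
namespace Paper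

variable (R : Type u) [CommRing R]

/-- `Ext^i_R(M,N)`, realized via Mathlib's derived-functor `Ext` for the
`R`-linear abelian category of `R`-modules. -/
abbrev ExtGrp (M N : Type u) [AddCommGroup M] [Module R M] [AddCommGroup N] [Module R N]
    (i : ℕ) : Type u :=
  ((Ext R (ModuleCat.{u} R) i).obj (Opposite.op (ModuleCat.of R M))).obj (ModuleCat.of R N)

/-- `Tor^R_i(M,N)`. -/
abbrev TorGrp (M N : Type u) [AddCommGroup M] [Module R M] [AddCommGroup N] [Module R N]
    (i : ℕ) : Type u :=
  ((Tor (ModuleCat.{u} R) i).obj (ModuleCat.of R M)).obj (ModuleCat.of R N)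

/-- Local cohomology `H^i_I(M)`. -/
abbrev LocCoh (I : Ideal R) (i : ℕ) (M : Type u) [AddCommGroup M] [Module R M] : Type u :=
  (localCohomology I i).obj (ModuleCat.of R M)

/-- A commutative ring is semiperfect iff it is a finite direct product of
commutative local rings. -/
def IsSemiperfectRing : Prop :=
  ∃ (n : ℕ) (A : Fin n → Type u) (c : ∀ i, CommRing (A i)),
    (∀ i, letI := c i; IsLocalRing (A i)) ∧
    (letI := c; Nonempty (R ≃+* ((i : Fin n) → A i)))

/-- `C` is a semidualizing `R`-module: `C` is finitely generated, the homothety map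
`R → Hom_R(C,C)` is bijective, and `Ext^i_R(C,C) = 0` for all `i > 0`. -/
def IsSemidualizing (C : Type u) [AddCommGroup C] [Module R C] : Prop :=
  Module.Finite R C ∧
  Function.Bijective (LinearMap.lsmul R C) ∧
  ∀ i : ℕ, 0 < i → Subsingleton (ExtGrp R C C i)

/-- A minimal projective presentation `P₁ → P₀ → M → 0` of `M`:
both `P₀ → M` and the induced `P₁ → ker(P₀ → M)` are projective covers
(surjections from finitely generated projectives with superfluous kernels). -/
structure MinPres (M : Type u) [AddCommGroup M] [Module R M] where
  P₁ : Type u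
  P₀ : Type u
  [acg₁ : AddCommGroup P₁]
  [acg₀ : AddCommGroup P₀]
  [mod₁ : Module R P₁]
  [mod₀ : Module R P₀]
  f : P₁ →ₗ[R] P₀
  g : P₀ →ₗ[R] M
  finite₁ : Module.Finite R P₁
  finite₀ : Module.Finite R P₀
  proj₁ : Module.Projective R P₁
  proj₀ : Module.Projective R P₀
  surj : Function.Surjective g
  exact : LinearMap.range f = LinearMap.ker g
  min₀ : ∀ N : Submodule R P₀, N ⊔ LinearMap.ker g = ⊤ → N = ⊤
  min₁ : ∀ N : Submodule R P₁, N ⊔ LinearMap.ker f = ⊤ → N = ⊤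

attribute [instance] MinPres.acg₁ MinPres.acg₀ MinPres.mod₁ MinPres.mod₀

variable {R}

/-- Given a minimal presentation `P₁ --f--> P₀ → X → 0` this is
`Hom(f,C) : Hom_R(P₀,C) → Hom_R(P₁,C)`; its image is `Ω_C Tr_C X` and its
cokernel is the transpose `Tr_C X` of `X` with respect to `C`. -/
def MinPres.homC {X : Type u} [AddCommGroup X] [Module R X]
    (C : Type u) [AddCommGroup C] [Module R C] (pres : MinPres R X) :
    (pres.P₀ →ₗ[R] C) →ₗ[R] (pres.P₁ →ₗ[R] C) :=
  LinearMap.lcomp R C pres.f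

/-- `Tr_C X` computed from a given minimal presentation. -/
def MinPres.trC {X : Type u} [AddCommGroup X] [Module R X]
    (C : Type u) [AddCommGroup C] [Module R C] (pres : MinPres R X) : Type u :=
  (pres.P₁ →ₗ[R] C) ⧸ LinearMap.range (pres.homC C)

instance {X : Type u} [AddCommGroup X] [Module R X] (C : Type u) [AddCommGroup C] [Module R C]
    (pres : MinPres R X) : AddCommGroup (pres.trC C) :=
  inferInstanceAs (AddCommGroup ((pres.P₁ →ₗ[R] C) ⧸ LinearMap.range (pres.homC C)))

instance {X : Type u} [AddCommGroup X] [Module R X] (C : Type u) [AddCommGroup C] [Module R C]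
    (pres : MinPres R X) : Module R (pres.trC C) :=
  inferInstanceAs (Module R ((pres.P₁ →ₗ[R] C) ⧸ LinearMap.range (pres.homC C)))

variable (R)

/-- `N ≅ Ω_C Tr_C X` : `N` is (isomorphic to) the image of `Hom(f,C)` for a
minimal projective presentation `P₁ --f--> P₀ → X → 0` of `X`. -/
def IsOmegaTrC (C : Type u) [AddCommGroup C] [Module R C]
    (X : Type u) [AddCommGroup X] [Module R X]
    (N : Type u) [AddCommGroup N] [Module R N] : Prop :=
  ∃ pres : MinPres R X, Nonempty (N ≃ₗ[R] ↥(LinearMap.range (pres.homC C)))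

/-- `N ≅ λ_R(C,M) = Ω_C Tr_C (Hom_R(C,M))`. -/
def IsLambdaOf (C : Type u) [AddCommGroup C] [Module R C]
    (M : Type u) [AddCommGroup M] [Module R M]
    (N : Type u) [AddCommGroup N] [Module R N] : Prop :=
  IsOmegaTrC R C (C →ₗ[R] M) N

/-- `M` is horizontally linked with respect to `C` : `M ≅ λ_R(C, λ_R(C,M))`. -/
def IsHorizontallyLinked (C : Type u) [AddCommGroup C] [Module R C]
    (M : Type u) [AddCommGroup M] [Module R M] : Prop :=
  ∃ N : ModuleCat.{u} R, IsLambdaOf R C M N ∧ IsLambdaOf R C N M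

/-- `M` is horizontally linked in the sense of Martsinkovsky–Strooker:
`M ≅ λ(λ M)` where `λ = Ω Tr`. -/
def IsHorizontallyLinkedMS (M : Type u) [AddCommGroup M] [Module R M] : Prop :=
  ∃ N : ModuleCat.{u} R, IsOmegaTrC R R M N ∧ IsOmegaTrC R R N M

/-- `underline-Hom_R(M,N) = 0` : every homomorphism `M → N` factors through a
projective module. -/
def StableHomZero (M N : Type u) [AddCommGroup M] [Module R M]
    [AddCommGroup N] [Module R N] : Prop :=
  ∀ φ : M →ₗ[R] N, ∃ P : ModuleCat.{u} R, Module.Projective R P ∧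
    ∃ (α : M →ₗ[R] P) (β : (P : Type u) →ₗ[R] N), β ∘ₗ α = φ

/-- `M` is `C`-stable: `M` has no nonzero direct summand of the form `P ⊗_R C`
with `P` projective. -/
def IsCStable (C M : Type u) [AddCommGroup C] [Module R C]
    [AddCommGroup M] [Module R M] : Prop :=
  ∀ N₁ N₂ : Submodule R M, IsCompl N₁ N₂ →
    ∀ P : ModuleCat.{u} R, Module.Projective R P →
      Nonempty (↥N₁ ≃ₗ[R] TensorProduct R P C) → N₁ = ⊥

/-- `M` is a `C`-syzygy: `M` embeds into a module `P ⊗_R C` with `P` projective. -/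
def IsCSyzygy (C M : Type u) [AddCommGroup C] [Module R C]
    [AddCommGroup M] [Module R M] : Prop :=
  ∃ P : ModuleCat.{u} R, Module.Projective R P ∧
    ∃ ι : M →ₗ[R] TensorProduct R (P : Type u) C, Function.Injective ι

/-- Auxiliary recursion for `n`-th `C`-syzygies. -/
def IsNthCSyzygyAux (C : Type u) [AddCommGroup C] [Module R C] :
    ℕ → ModuleCat.{u} R → Prop
  | 0, _ => True
  | (m+1), M =>
    ∃ P : ModuleCat.{u} R, Module.Projective R P ∧
      ∃ ι : (M : Type u) →ₗ[R] TensorProduct R (P : Type u) C, Function.Injective ι ∧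
        IsNthCSyzygyAux C m
          (ModuleCat.of R (TensorProduct R (P : Type u) C ⧸ LinearMap.range ι))

/-- `M` is an `n`-th `C`-syzygy: there is an exact sequence
`0 → M → C₁ → ⋯ → C_n` with each `C_j` of the form `P_j ⊗_R C`, `P_j` projective. -/
def IsNthCSyzygy (n : ℕ) (C M : Type u) [AddCommGroup C] [Module R C]
    [AddCommGroup M] [Module R M] : Prop :=
  IsNthCSyzygyAux R C n (ModuleCat.of R M)

/-- The biduality map `M → Hom_R(Hom_R(M,C),C)`. -/
def bidualityMap (C M : Type u) [AddCommGroup C] [Module R C]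
    [AddCommGroup M] [Module R M] : M →ₗ[R] ((M →ₗ[R] C) →ₗ[R] C) :=
  (LinearMap.id : (M →ₗ[R] C) →ₗ[R] (M →ₗ[R] C)).flip

/-- `M` has `G_C`-dimension zero. -/
def GCdimZero (C M : Type u) [AddCommGroup C] [Module R C]
    [AddCommGroup M] [Module R M] : Prop :=
  Module.Finite R M ∧
  Function.Bijective (bidualityMap R C M) ∧
  (∀ i : ℕ, 0 < i → Subsingleton (ExtGrp R M C i)) ∧
  (∀ i : ℕ, 0 < i → Subsingleton (ExtGrp R (M →ₗ[R] C) C i))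

/-- `G_C`-dim`_R(M) ≤ n`: there is a resolution of `M` of length `≤ n` by modules of
`G_C`-dimension zero. -/
def GCdimLE (C M : Type u) [AddCommGroup C] [Module R C]
    [AddCommGroup M] [Module R M] (n : ℕ) : Prop :=
  ∃ (G : ℕ → ModuleCat.{u} R) (d : ∀ i : ℕ, (G (i+1) : Type u) →ₗ[R] G i)
    (ε : (G 0 : Type u) →ₗ[R] M),
    Function.Surjective ε ∧
    LinearMap.range (d 0) = LinearMap.ker ε ∧
    (∀ i : ℕ, LinearMap.range (d (i+1)) = LinearMap.ker (d i)) ∧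
    (∀ i : ℕ, GCdimZero R C (G i)) ∧
    (∀ i : ℕ, n < i → Subsingleton (G i))

/-- `G_C`-dim`_R(M) < ∞`. -/
def GCdimFinite (C M : Type u) [AddCommGroup C] [Module R C]
    [AddCommGroup M] [Module R M] : Prop :=
  ∃ n : ℕ, GCdimLE R C M n

/-- The "depth of `I` on `M`" (classical grade): `inf{ i | Ext^i_R(R/I, M) ≠ 0 }`,
as an extended natural number. -/
def edepth (I : Ideal R) (M : Type u) [AddCommGroup M] [Module R M] : ℕ∞ :=
  sInf {n : ℕ∞ | ∃ i : ℕ, n = i ∧ Nontrivial (ExtGrp R (R ⧸ I) M i)}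

/-- The depth of a module over a local ring. -/
def ldepth [IsLocalRing R] (M : Type u) [AddCommGroup M] [Module R M] : ℕ∞ :=
  edepth R (IsLocalRing.maximalIdeal R) M

/-- `depth_{R_p}(M_p)`. -/
def depthAt (p : Ideal R) [p.IsPrime] (M : Type u) [AddCommGroup M] [Module R M] : ℕ∞ :=
  ldepth (Localization.AtPrime p) (LocalizedModule p.primeCompl M)

/-- `depth R_p`. -/
def ringDepthAt (p : Ideal R) [p.IsPrime] : ℕ∞ :=
  ldepth (Localization.AtPrime p) (Localization.AtPrime p)

/-- Serre's condition `(S̃_n)`: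
`depth_{R_p}(M_p) ≥ min{n, depth R_p}` for all primes `p`. -/
def SerreTilde (n : ℕ) (M : Type u) [AddCommGroup M] [Module R M] : Prop :=
  ∀ (p : Ideal R) (_ : p.IsPrime), min (n : ℕ∞) (ringDepthAt R p) ≤ depthAt R p M

/-- Serre's condition `(S_n)`:
`depth_{R_p}(M_p) ≥ min{n, dim R_p}` for all primes `p`. -/
def SerreS (n : ℕ) (M : Type u) [AddCommGroup M] [Module R M] : Prop :=
  ∀ (p : Ideal R) (_ : p.IsPrime),
    min (n : WithBot ℕ∞) (ringKrullDim (Localization.AtPrime p)) ≤ (depthAt R p M : WithBot ℕ∞)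

/-- The dimension of a module: `dim_R(M) = dim (R / ann_R M)`. -/
def moduleDim (M : Type u) [AddCommGroup M] [Module R M] : WithBot ℕ∞ :=
  ringKrullDim (R ⧸ Module.annihilator R M)

/-- A Cohen-Macaulay module over a local ring: `depth_R(M) = dim_R(M)`. -/
def IsCMModule [IsLocalRing R] (M : Type u) [AddCommGroup M] [Module R M] : Prop :=
  (ldepth R M : WithBot ℕ∞) = moduleDim R M

/-- A maximal Cohen-Macaulay module over a local ring: `depth_R(M) = dim R`. -/
def IsMaximalCM [IsLocalRing R] (M : Type u) [AddCommGroup M] [Module R M] : Prop :=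
  (ldepth R M : WithBot ℕ∞) = ringKrullDim R

/-- A Cohen-Macaulay local ring. -/
def IsCMLocalRing : Prop :=
  ∃ _ : IsLocalRing R, (ldepth R R : WithBot ℕ∞) = ringKrullDim R

/-- `C` has finite injective dimension: for some `n`, `Ext^i_R(-,C)` vanishes
for all `i > n`. -/
def HasFiniteInjDim (C : Type u) [AddCommGroup C] [Module R C] : Prop :=
  ∃ n : ℕ, ∀ (M : ModuleCat.{u} R) (i : ℕ), n < i →
    Subsingleton (((Ext R (ModuleCat.{u} R) i).obj (Opposite.op M)).obj (ModuleCat.of R C))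

/-- `ω` is a canonical module of `R`: a semidualizing module of finite injective
dimension. -/
def IsCanonicalModule (ω : Type u) [AddCommGroup ω] [Module R ω] : Prop :=
  IsSemidualizing R ω ∧ HasFiniteInjDim R ω

/-- `Gid_R(M) ≤ n`: there is an exact complex `⋯ → I_1 → I_0 → I_{-1} → ⋯` of
injective modules, which stays exact under `Hom_R(E,-)` for every injective `E`,
with `M ≅ ker(I_0 → I_{-1})` and `I_j = 0` for `j < -n`. -/
def GidLE (M : Type u) [AddCommGroup M] [Module R M] (n : ℕ) : Prop :=
  ∃ (I : ℤ → ModuleCat.{u} R) (d : ∀ i : ℤ, (I (i+1) : Type u) →ₗ[R] I i),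
    (∀ i : ℤ, Module.Injective R (I i)) ∧
    (∀ i : ℤ, LinearMap.range (d (i+1)) = LinearMap.ker (d i)) ∧
    (∀ E : ModuleCat.{u} R, Module.Injective R E →
      ∀ (i : ℤ) (φ : (E : Type u) →ₗ[R] I (i+1)), d i ∘ₗ φ = 0 →
        ∃ ψ : (E : Type u) →ₗ[R] I (i+1+1), d (i+1) ∘ₗ ψ = φ) ∧
    Nonempty (M ≃ₗ[R] ↥(LinearMap.ker (d (-1)))) ∧
    (∀ i : ℤ, i < -(n : ℤ) → Subsingleton (I i))

/-- `M` has finite Gorenstein injective dimension. -/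
def HasFiniteGid (M : Type u) [AddCommGroup M] [Module R M] : Prop :=
  ∃ n : ℕ, GidLE R M n

/-- The evaluation map `C ⊗_R Hom_R(C,M) → M`. -/
def evalMap (C M : Type u) [AddCommGroup C] [Module R C]
    [AddCommGroup M] [Module R M] : TensorProduct R C (C →ₗ[R] M) →ₗ[R] M :=
  TensorProduct.lift ((LinearMap.id : (C →ₗ[R] M) →ₗ[R] (C →ₗ[R] M)).flip)

/-- Membership in the Bass class `B_C`. -/
def MemBass (C M : Type u) [AddCommGroup C] [Module R C]
    [AddCommGroup M] [Module R M] : Prop :=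
  Function.Bijective (evalMap R C M) ∧
  (∀ i : ℕ, 0 < i → Subsingleton (TorGrp R (C →ₗ[R] M) C i)) ∧
  (∀ i : ℕ, 0 < i → Subsingleton (ExtGrp R C M i))

/-- Membership in the Auslander class `A_C`. -/
def MemAus (C M : Type u) [AddCommGroup C] [Module R C]
    [AddCommGroup M] [Module R M] : Prop :=
  Function.Bijective (TensorProduct.mk R M C) ∧
  (∀ i : ℕ, 0 < i → Subsingleton (TorGrp R M C i)) ∧
  (∀ i : ℕ, 0 < i → Subsingleton (ExtGrp R C (TensorProduct R M C) i))

/-- The grade of a module: the common length of maximal `R`-regular sequences in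
`ann_R(M)`, i.e. `inf{ i | Ext^i(R/ann M, R) ≠ 0 }`. -/
def gradeMod (M : Type u) [AddCommGroup M] [Module R M] : ℕ∞ :=
  edepth R (Module.annihilator R M) R

/-- The grade of an ideal `I`, i.e. `grade_R(R/I)`. -/
def gradeIdeal (I : Ideal R) : ℕ∞ :=
  edepth R I R

/-- An unmixed ideal: every associated prime of `R/I` is a minimal prime of `I`. -/
def IsUnmixedIdeal (I : Ideal R) : Prop :=
  ∀ p ∈ associatedPrimes R (R ⧸ I), p ∈ I.minimalPrimes

/-- Equality of the `a`-th Bass number of `R` (over `R`, w.r.t. the maximal ideal `m`)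
and the `b`-th Bass number of `A` (over `A`, w.r.t. the maximal ideal `mA`): both Ext
modules are vector spaces over the corresponding residue fields of one and the same
dimension. -/
def BassNumbersEq (m : Ideal R) (a : ℕ) (A : Type u) [CommRing A] (mA : Ideal A) (b : ℕ) : Prop :=
  ∃ ι : Type u,
    Nonempty (ExtGrp R (R ⧸ m) R a ≃ₗ[R] (ι →₀ (R ⧸ m))) ∧
    Nonempty (ExtGrp A (A ⧸ mA) A b ≃ₗ[A] (ι →₀ (A ⧸ mA)))

/-- A quasi-Gorenstein ideal of a local ring `R`: `G-dim_R(R/a) < ∞` and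
`μ^{i+depth R}_R(R) = μ^{i+depth R/a}_{R/a}(R/a)` for all `i ≥ 0`. -/
def IsQuasiGorensteinIdeal [IsLocalRing R] (a : Ideal R) : Prop :=
  GCdimFinite R R (R ⧸ a) ∧
  ∀ i : ℕ,
    BassNumbersEq R (IsLocalRing.maximalIdeal R) (i + (ldepth R R).toNat)
      (R ⧸ a) (Ideal.map (Ideal.Quotient.mk a) (IsLocalRing.maximalIdeal R))
      (i + (edepth (R ⧸ a) (Ideal.map (Ideal.Quotient.mk a) (IsLocalRing.maximalIdeal R))
        (R ⧸ a)).toNat)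

/-- `E` is an injective hull of `K`: `E` is injective and contains a copy of `K`
as an essential submodule. -/
def IsInjectiveHull (K E : Type u) [AddCommGroup K] [Module R K]
    [AddCommGroup E] [Module R E] : Prop :=
  Module.Injective R E ∧
  ∃ ι : K →ₗ[R] E, Function.Injective ι ∧
    ∀ N : Submodule R E, N ≠ ⊥ → N ⊓ LinearMap.range ι ≠ ⊥

/-- A generalized Cohen-Macaulay module over a local ring: `dim M ≥ 1` and
`H^i_m(M)` has finite length for all `i < dim M`. -/
def IsGeneralizedCM [IsLocalRing R] (M : Type u) [AddCommGroup M] [Module R M] : Prop :=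
  1 ≤ moduleDim R M ∧
  ∀ i : ℕ, (i : WithBot ℕ∞) < moduleDim R M →
    IsFiniteLength R (LocCoh R (IsLocalRing.maximalIdeal R) i M)

end Paper

namespace ExtComparison

variable {R : Type u} [CommRing R]

/-- The contravariant Hom functor into `Y`, viewed as a covariant functor to the opposite category. -/
abbrev homOp (Y : ModuleCat.{u} R) : ModuleCat.{u} R ⥤ (ModuleCat.{u} R)ᵒᵖ :=
  ((linearYoneda R (ModuleCat.{u} R)).obj Y).rightOp

/-- The value of Mathlib's derived functor `Ext`. -/
abbrev extObj (n : ℕ) (X Y : ModuleCat.{u} R) : ModuleCat.{u} R :=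
  ((Ext R (ModuleCat.{u} R) n).obj (Opposite.op X)).obj Y

variable {X Y : ModuleCat.{u} R} (P : ProjectiveResolution X)

/-- `Hom(P, Y)` as a complex in the opposite category. -/
abbrev homComplex (Y : ModuleCat.{u} R) : ChainComplex (ModuleCat.{u} R)ᵒᵖ ℕ :=
  ((homOp Y).mapHomologicalComplex _).obj P.complex

/-- The module of cocycles of `Hom(P, Y)`. -/
def cocyc (Y : ModuleCat.{u} R) (n : ℕ) : ModuleCat.{u} R :=
  ((homComplex P Y).opcycles n).unop

/-- The inclusion of cocycles into `Hom(P_n, Y)`. -/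
def cocycInc (Y : ModuleCat.{u} R) (n : ℕ) :
    cocyc P Y n ⟶ ModuleCat.of R (P.complex.X n ⟶ Y) :=
  ((homComplex P Y).pOpcycles n).unop

/-- The projection of cocycles to `Ext`. -/
def cocycProj (Y : ModuleCat.{u} R) (n : ℕ) :
    cocyc P Y n ⟶ extObj n X Y :=
  ((P.isoLeftDerivedObj (homOp Y) n).hom ≫ (homComplex P Y).homologyι n).unop

lemma cocycInc_injective (Y : ModuleCat.{u} R) (n : ℕ) :
    Function.Injective (cocycInc P Y n) :=
  (ModuleCat.mono_iff_injective _).1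
    (unop_mono_of_epi ((homComplex P Y).pOpcycles n))

lemma cocycProj_surjective (Y : ModuleCat.{u} R) (n : ℕ) :
    Function.Surjective (cocycProj P Y n) :=
  (ModuleCat.epi_iff_surjective _).1
    (@unop_epi_of_mono _ _ _ _ ((P.isoLeftDerivedObj (homOp Y) n).hom ≫ (homComplex P Y).homologyι n)
      (mono_comp' (inferInstanceAs (Mono (P.isoLeftDerivedObj (homOp Y) n).hom))
        (inferInstanceAs (Mono ((homComplex P Y).homologyι n)))))

lemma cocycInc_range (Y : ModuleCat.{u} R) (n : ℕ) (f : P.complex.X n ⟶ Y) :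
    P.complex.d (n + 1) n ≫ f = 0 ↔ ∃ w : cocyc P Y n, cocycInc P Y n w = f := by
  have h : (ShortComplex.mk ((homComplex P Y).d (n + 1) n) ((homComplex P Y).pOpcycles n)
      ((homComplex P Y).d_pOpcycles _ _)).Exact :=
    ShortComplex.exact_of_g_is_cokernel _ ((homComplex P Y).opcyclesIsCokernel (n + 1) n (by simp))
  have h2 := (ShortComplex.ShortExact.moduleCat_exact_iff_function_exact _).1 h.unop
  exact h2 f

lemma cocycProj_eq_zero_succ (Y : ModuleCat.{u} R) (n : ℕ) (w : cocyc P Y (n + 1)) :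
    cocycProj P Y (n + 1) w = 0 ↔
      ∃ g : P.complex.X n ⟶ Y, P.complex.d (n + 1) n ≫ g = cocycInc P Y (n + 1) w := by
  have h : (ShortComplex.mk ((homComplex P Y).homologyι (n + 1))
      ((homComplex P Y).fromOpcycles (n + 1) n)
      ((homComplex P Y).homologyι_comp_fromOpcycles _ _)).Exact :=
    ShortComplex.exact_of_f_is_kernel _
      ((homComplex P Y).homologyIsKernel (n + 1) n (by simp))
  have h2 := (ShortComplex.ShortExact.moduleCat_exact_iff_function_exact _).1 h.unop
  have h3 : cocycProj P Y (n + 1) w = 0 ↔ ((homComplex P Y).homologyι (n + 1)).unop w = 0 := by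
    have : cocycProj P Y (n + 1) w = ((P.isoLeftDerivedObj (homOp Y) (n + 1)).hom).unop
      (((homComplex P Y).homologyι (n + 1)).unop w) := rfl
    rw [this]
    have hm : Function.Injective ((P.isoLeftDerivedObj (homOp Y) (n + 1)).hom).unop :=
      (ModuleCat.mono_iff_injective _).1 inferInstance
    exact map_eq_zero_iff _ hm
  rw [h3]
  refine (h2 w).trans ?_
  constructor
  · rintro ⟨g, hg⟩
    refine ⟨g, ?_⟩
    rw [← hg]
    have := congrArg (fun φ => φ.unop g)
      ((homComplex P Y).p_fromOpcycles (n + 1) n)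
    exact this.symm
  · rintro ⟨g, hg⟩
    refine ⟨g, cocycInc_injective P Y (n + 1) ?_⟩
    rw [← hg]
    have := congrArg (fun φ => φ.unop g)
      ((homComplex P Y).p_fromOpcycles (n + 1) n)
    exact this

lemma cocycProj_zero_injective (Y : ModuleCat.{u} R) :
    Function.Injective (cocycProj P Y 0) := by
  have h : IsIso ((homComplex P Y).homologyι 0) := by
    have : (homComplex P Y).sc 0 = (homComplex P Y).sc 0 := rfl
    exact (homComplex P Y).isIso_homologyι 0 _ rfl (by simp)
  exact (ModuleCat.mono_iff_injective _).1
    (@unop_mono_of_epi _ _ _ _ ((P.isoLeftDerivedObj (homOp Y) 0).hom ≫ (homComplex P Y).homologyι 0)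
      (epi_comp' (inferInstanceAs (Epi (P.isoLeftDerivedObj (homOp Y) 0).hom))
        (inferInstanceAs (Epi ((homComplex P Y).homologyι 0)))))


lemma cocycProj_precomp {X' : ModuleCat.{u} R} (f : X' ⟶ X) (P' : ProjectiveResolution X')
    (φ : ProjectiveResolution.Hom P' P f) (n : ℕ) (w : cocyc P Y n) :
    ∃ w' : cocyc P' Y n, cocycInc P' Y n w' = φ.hom.f n ≫ cocycInc P Y n w ∧
      cocycProj P' Y n w' = ((Ext R (ModuleCat.{u} R) n).map f.op).app Y (cocycProj P Y n w) := by
  let ψ := ((homOp Y).mapHomologicalComplex (ComplexShape.down ℕ)).map φ.hom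
  refine ⟨(HomologicalComplex.opcyclesMap ψ n).unop w, ?_, ?_⟩
  · exact congrArg (fun φ => φ.unop w) (HomologicalComplex.p_opcyclesMap ψ n)
  · have h1 := congrArg (fun φ => φ.unop w) (HomologicalComplex.homologyι_naturality ψ n)
    have h2 := congrArg (fun φ => φ.unop (((homComplex P Y).homologyι n).unop w))
      (ProjectiveResolution.isoLeftDerivedObj_hom_naturality f P' P φ.hom
        (by simpa using φ.hom_f_zero_comp_π_f_zero) (homOp Y) n)
    have h3 := congrArg (fun z => (P'.isoLeftDerivedObj (homOp Y) n).hom.unop z) h1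
    exact h3.symm.trans h2.symm

lemma cocycInc_cocycle (Y : ModuleCat.{u} R) (n : ℕ) (w : cocyc P Y n) :
    P.complex.d (n + 1) n ≫ (cocycInc P Y n w : P.complex.X n ⟶ Y) = 0 :=
  (cocycInc_range P Y n _).2 ⟨w, rfl⟩

lemma smul_extMk (n : ℕ) (f : P.complex.X n ⟶ Y) (hf : P.complex.d (n + 1) n ≫ f = 0) (r : R) :
    r • P.extMk f (n + 1) rfl hf = P.extMk (r • f) (n + 1) rfl (by simp [hf]) := by
  rw [Abelian.Ext.smul_eq_comp_mk₀, ProjectiveResolution.extMk_comp_mk₀]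
  congr 1

lemma extMk_zero_eq_zero (f : P.complex.X 0 ⟶ Y) (hf : P.complex.d 1 0 ≫ f = 0)
    (h : P.extMk f 1 rfl hf = 0) : f = 0 := by
  have h' := congrArg P.extEquivCohomologyClass h
  rw [ProjectiveResolution.extEquivCohomologyClass_extMk,
    ProjectiveResolution.extEquivCohomologyClass_zero,
    CochainComplex.HomComplex.CohomologyClass.mk_eq_zero_iff,
    CochainComplex.HomComplex.Cocycle.toSingleMk_mem_coboundaries_iff _ _ _ _ _ 1 (by lia)] at h'
  obtain ⟨g, hg⟩ := h'
  have hz : Limits.IsZero (P.cochainComplex.X 1) :=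
    P.cochainComplex.isZero_of_isStrictlyLE 0 1 (by lia)
  rw [hz.eq_of_src g 0, Limits.comp_zero] at hg
  have := congrArg (fun z => (P.cochainComplexXIso (-(0:ℕ)) 0 rfl).inv ≫ z) hg
  simpa using this.symm

/-- The class map from cocycles to `Ext` groups. -/
def cocycClass (Y : ModuleCat.{u} R) (n : ℕ) : cocyc P Y n →ₗ[R] Abelian.Ext X Y n where
  toFun w := P.extMk (cocycInc P Y n w) (n + 1) rfl (cocycInc_cocycle P Y n w)
  map_add' a b := by
    rw [ProjectiveResolution.add_extMk]
    congr 1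
    exact map_add (cocycInc P Y n).hom a b
  map_smul' r a := by
    rw [RingHom.id_apply, smul_extMk]
    congr 1
    exact map_smul (cocycInc P Y n).hom r a

lemma cocycClass_eq (Y : ModuleCat.{u} R) (n : ℕ) (w : cocyc P Y n) (f : P.complex.X n ⟶ Y)
    (hf : P.complex.d (n + 1) n ≫ f = 0) (h : cocycInc P Y n w = f) :
    cocycClass P Y n w = P.extMk f (n + 1) rfl hf := by
  subst h
  rfl

lemma cocycClass_surjective (Y : ModuleCat.{u} R) (n : ℕ) :
    Function.Surjective (cocycClass P Y n) := by
  intro a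
  obtain ⟨f, hf, rfl⟩ := P.extMk_surjective a (n + 1) rfl
  obtain ⟨w, rfl⟩ := (cocycInc_range P Y n f).1 hf
  exact ⟨w, rfl⟩

lemma cocycClass_ker (Y : ModuleCat.{u} R) (n : ℕ) :
    LinearMap.ker (cocycProj P Y n).hom = LinearMap.ker (cocycClass P Y n) := by
  ext w
  rw [LinearMap.mem_ker, LinearMap.mem_ker]
  cases n with
  | zero =>
    have h1 : cocycProj P Y 0 w = 0 ↔ w = 0 :=
      map_eq_zero_iff (cocycProj P Y 0).hom (cocycProj_zero_injective P Y)
    refine h1.trans ⟨fun h => by rw [h, map_zero], fun h => ?_⟩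
    apply cocycInc_injective P Y 0
    rw [extMk_zero_eq_zero P _ (cocycInc_cocycle P Y 0 w) h]
    exact (map_zero (cocycInc P Y 0).hom).symm
  | succ n =>
    exact (cocycProj_eq_zero_succ P Y n w).trans (P.extMk_eq_zero_iff _ _ rfl
      (cocycInc_cocycle P Y (n + 1) w) n rfl).symm

/-- Mathlib's derived functor `Ext` agrees with the `Ext` groups of the derived category. -/
def extEquiv (n : ℕ) (X Y : ModuleCat.{u} R) : extObj n X Y ≃ₗ[R] Abelian.Ext X Y n :=
  ((cocycProj (projectiveResolution X) Y n).hom.quotKerEquivOfSurjective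
      (cocycProj_surjective _ Y n)).symm ≪≫ₗ
    Submodule.quotEquivOfEq _ _ (cocycClass_ker (projectiveResolution X) Y n) ≪≫ₗ
    (cocycClass (projectiveResolution X) Y n).quotKerEquivOfSurjective
      (cocycClass_surjective _ Y n)

lemma extEquiv_cocycProj (n : ℕ) (X Y : ModuleCat.{u} R)
    (w : cocyc (projectiveResolution X) Y n) :
    extEquiv n X Y (cocycProj (projectiveResolution X) Y n w) = cocycClass _ Y n w := by
  have : ((cocycProj (projectiveResolution X) Y n).hom.quotKerEquivOfSurjective
      (cocycProj_surjective _ Y n)).symm (cocycProj (projectiveResolution X) Y n w) =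
      Submodule.Quotient.mk w := by
    rw [LinearEquiv.symm_apply_eq]
    rfl
  simp only [extEquiv, LinearEquiv.trans_apply, this]
  rfl

lemma extEquiv_precomp (n : ℕ) {X X' : ModuleCat.{u} R} (f : X' ⟶ X) (Y : ModuleCat.{u} R)
    (a : extObj n X Y) :
    extEquiv n X' Y (((Ext R (ModuleCat.{u} R) n).map f.op).app Y a) =
      (Abelian.Ext.mk₀ f).comp (extEquiv n X Y a) (zero_add n) := by
  obtain ⟨w, rfl⟩ := cocycProj_surjective (projectiveResolution X) Y n a
  let φ : ProjectiveResolution.Hom (projectiveResolution X') (projectiveResolution X) f :=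
    { hom := ProjectiveResolution.lift f _ _
      hom_f_zero_comp_π_f_zero := by
        have := ProjectiveResolution.lift_commutes_zero f (projectiveResolution X')
          (projectiveResolution X)
        exact this }
  obtain ⟨w', h1, h2⟩ := cocycProj_precomp (projectiveResolution X) f
    (projectiveResolution X') φ n w
  rw [← h2, extEquiv_cocycProj, extEquiv_cocycProj]
  refine Eq.trans ?_ (ProjectiveResolution.mk₀_comp_extMk _ _ rfl
    (cocycInc_cocycle (projectiveResolution X) Y n w) φ).symm
  exact cocycClass_eq _ _ _ _ _ _ h1

end ExtComparison

namespace ModExt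

variable {R : Type u} [CommRing R]

section Basic

variable (R) in
/-- The `Ext` groups of the derived category, for unbundled modules. -/
abbrev E (A B : Type u) [AddCommGroup A] [Module R A] [AddCommGroup B] [Module R B] (n : ℕ) :
    Type u :=
  Abelian.Ext (ModuleCat.of R A) (ModuleCat.of R B) n

variable {A A' A'' B B' B'' D Y : Type u} [AddCommGroup A] [Module R A] [AddCommGroup B]
  [Module R B] [AddCommGroup D] [Module R D] [AddCommGroup A'] [Module R A'] [AddCommGroup B']
  [Module R B'] [AddCommGroup Y] [Module R Y] [AddCommGroup A''] [Module R A'']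
  [AddCommGroup B''] [Module R B'']

/-- Precomposition on `Ext`. -/
def pre (n : ℕ) (f : A' →ₗ[R] A) (B : Type u) [AddCommGroup B] [Module R B] :
    E R A B n →ₗ[R] E R A' B n :=
  Abelian.Ext.bilinearCompOfLinear R _ _ _ 0 n n (zero_add n) (Abelian.Ext.mk₀ (ModuleCat.ofHom f))

/-- Postcomposition on `Ext`. -/
def post (n : ℕ) (A : Type u) [AddCommGroup A] [Module R A] (g : B →ₗ[R] B') :
    E R A B n →ₗ[R] E R A B' n :=
  (Abelian.Ext.bilinearCompOfLinear R _ _ _ n 0 n (add_zero n)).flip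
    (Abelian.Ext.mk₀ (ModuleCat.ofHom g))

lemma pre_apply (n : ℕ) (f : A' →ₗ[R] A) (x : E R A B n) :
    pre n f B x = (Abelian.Ext.mk₀ (ModuleCat.ofHom f)).comp x (zero_add n) := rfl

lemma post_apply (n : ℕ) (g : B →ₗ[R] B') (x : E R A B n) :
    post n A g x = x.comp (Abelian.Ext.mk₀ (ModuleCat.ofHom g)) (add_zero n) := rfl

lemma pre_pre (n : ℕ) (f : A' →ₗ[R] A) (f' : A'' →ₗ[R] A') (x : E R A B n) :
    pre n f' B (pre n f B x) = pre n (f ∘ₗ f') B x := by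
  simp [pre_apply]

lemma post_post (n : ℕ) (g : B →ₗ[R] B') (g' : B' →ₗ[R] B'') (x : E R A B n) :
    post n A g' (post n A g x) = post n A (g' ∘ₗ g) x := by
  simp [post_apply]

lemma pre_post (n : ℕ) (f : A' →ₗ[R] A) (g : B →ₗ[R] B') (x : E R A B n) :
    pre n f B' (post n A g x) = post n A' g (pre n f B x) := by
  simp only [pre_apply, post_apply]
  exact (Abelian.Ext.comp_assoc_of_third_deg_zero _ _ _ _).symm

lemma pre_id (n : ℕ) (x : E R A B n) : pre n LinearMap.id B x = x :=
  Abelian.Ext.mk₀_id_comp x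

lemma post_id (n : ℕ) (x : E R A B n) : post n A LinearMap.id x = x :=
  Abelian.Ext.comp_mk₀_id x

lemma pre_smul_id (n : ℕ) (r : R) (x : E R A B n) :
    pre n (r • LinearMap.id : A →ₗ[R] A) B x = r • x := by
  have : ModuleCat.ofHom (r • LinearMap.id : A →ₗ[R] A) = r • 𝟙 (ModuleCat.of R A) := rfl
  rw [pre_apply, this, Abelian.Ext.mk₀_smul, Abelian.Ext.smul_comp, Abelian.Ext.mk₀_id_comp]

lemma post_smul (n : ℕ) (r : R) (g : B →ₗ[R] B') (x : E R A B n) :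
    post n A (r • g) x = r • post n A g x := by
  have : ModuleCat.ofHom (r • g) = r • ModuleCat.ofHom g := rfl
  rw [post_apply, this, Abelian.Ext.mk₀_smul, Abelian.Ext.comp_smul, post_apply]

lemma post_smul_id (n : ℕ) (r : R) (x : E R A B n) :
    post n A (r • LinearMap.id : B →ₗ[R] B) x = r • x := by
  rw [post_smul, post_id]

lemma post_add (n : ℕ) (g g' : B →ₗ[R] B') (x : E R A B n) :
    post n A (g + g') x = post n A g x + post n A g' x := by
  have : ModuleCat.ofHom (g + g') = ModuleCat.ofHom g + ModuleCat.ofHom g' := rfl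
  rw [post_apply, this, Abelian.Ext.mk₀_add, Abelian.Ext.comp_add, post_apply, post_apply]

lemma post_zero (n : ℕ) (x : E R A B n) : post n A (0 : B →ₗ[R] B') x = 0 := by
  have := post_smul n (0 : R) (0 : B →ₗ[R] B') x
  simpa using this

lemma pre_zero (n : ℕ) (x : E R A B n) : pre n (0 : A' →ₗ[R] A) B x = 0 := by
  have : ModuleCat.ofHom (0 : A' →ₗ[R] A) = 0 := rfl
  rw [pre_apply, this, Abelian.Ext.mk₀_zero, Abelian.Ext.zero_comp]

/-- `Ext` in degree zero is `Hom`. -/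
def homEquiv (A B : Type u) [AddCommGroup A] [Module R A] [AddCommGroup B] [Module R B] :
    E R A B 0 ≃ₗ[R] (A →ₗ[R] B) :=
  Abelian.Ext.linearEquiv₀ ≪≫ₗ ModuleCat.homLinearEquiv

lemma homEquiv_symm_apply (f : A →ₗ[R] B) :
    (homEquiv A B).symm f = Abelian.Ext.mk₀ (ModuleCat.ofHom f) := rfl

lemma homEquiv_pre (f : A' →ₗ[R] A) (x : E R A B 0) :
    homEquiv A' B (pre 0 f B x) = homEquiv A B x ∘ₗ f := by
  obtain ⟨y, rfl⟩ := (homEquiv A B).symm.surjective x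
  rw [LinearEquiv.apply_symm_apply, ← LinearEquiv.eq_symm_apply, homEquiv_symm_apply,
    homEquiv_symm_apply, pre_apply]
  simp

lemma homEquiv_post (g : B →ₗ[R] B') (x : E R A B 0) :
    homEquiv A B' (post 0 A g x) = g ∘ₗ homEquiv A B x := by
  obtain ⟨y, rfl⟩ := (homEquiv A B).symm.surjective x
  rw [LinearEquiv.apply_symm_apply, ← LinearEquiv.eq_symm_apply, homEquiv_symm_apply,
    homEquiv_symm_apply, post_apply]
  simp

lemma post_zero_injective (g : B →ₗ[R] B') (hg : Function.Injective g) :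
    Function.Injective (post 0 A g) := by
  intro x y h
  apply (homEquiv A B).injective
  have h2 := congrArg (homEquiv A B') h
  rw [homEquiv_post, homEquiv_post] at h2
  exact LinearMap.cancel_left hg |>.1 h2

/-- Precomposition with an isomorphism. -/
def preEquiv (n : ℕ) (e : A ≃ₗ[R] A') (B : Type u) [AddCommGroup B] [Module R B] :
    E R A' B n ≃ₗ[R] E R A B n :=
  LinearEquiv.ofLinearMap (pre n e.toLinearMap B) (pre n e.symm.toLinearMap B)
    (by ext x; simp [pre_pre, pre_id]) (by ext x; simp [pre_pre, pre_id])

/-- Postcomposition with an isomorphism. -/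
def postEquiv (n : ℕ) (A : Type u) [AddCommGroup A] [Module R A] (e : B ≃ₗ[R] B') :
    E R A B n ≃ₗ[R] E R A B' n :=
  LinearEquiv.ofLinearMap (post n A e.toLinearMap) (post n A e.symm.toLinearMap)
    (by ext x; simp [post_post, post_id]) (by ext x; simp [post_post, post_id])

lemma subsingleton_of_projective [Module.Projective R A] (n : ℕ) :
    Subsingleton (E R A B (n + 1)) := by
  have : Projective (ModuleCat.of R A) := by
    rw [← IsProjective.iff_projective]; infer_instance
  exact Abelian.Ext.subsingleton_of_projective _ _ n

lemma subsingleton_of_injective [hB : Module.Injective R B] (n : ℕ) :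
    Subsingleton (E R A B (n + 1)) := by
  have : Injective (ModuleCat.of R B) := Module.injective_object_of_injective_module R B
  exact Abelian.Ext.subsingleton_of_injective _ _ n

end Basic

/-- Short exact sequences of unbundled modules. -/
structure SES {A B D : Type u} [AddCommGroup A] [Module R A] [AddCommGroup B] [Module R B]
    [AddCommGroup D] [Module R D] (f : A →ₗ[R] B) (g : B →ₗ[R] D) : Prop where
  inj : Function.Injective f
  exact : Function.Exact f g
  surj : Function.Surjective g

namespace SES

variable {A B D X Y : Type u} [AddCommGroup A] [Module R A] [AddCommGroup B] [Module R B]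
  [AddCommGroup D] [Module R D] [AddCommGroup X] [Module R X] [AddCommGroup Y] [Module R Y]
  {f : A →ₗ[R] B} {g : B →ₗ[R] D} (s : SES f g)

include s in
lemma comp_eq_zero : g ∘ₗ f = 0 := s.exact.linearMap_comp_eq_zero

/-- The bundled short complex of a short exact sequence. -/
abbrev toShortComplex : ShortComplex (ModuleCat.{u} R) :=
  ShortComplex.mk (ModuleCat.ofHom f) (ModuleCat.ofHom g) (by
    rw [← ModuleCat.ofHom_comp, s.comp_eq_zero]; rfl)

lemma shortExact : s.toShortComplex.ShortExact where
  exact := (ShortComplex.ShortExact.moduleCat_exact_iff_function_exact _).2 s.exact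
  mono_f := (ModuleCat.mono_iff_injective _).2 s.inj
  epi_g := (ModuleCat.epi_iff_surjective _).2 s.surj

/-- The contravariant connecting map. -/
def preδ (Y : Type u) [AddCommGroup Y] [Module R Y] (n : ℕ) :
    E R A Y n →ₗ[R] E R D Y (n + 1) :=
  Abelian.Ext.bilinearCompOfLinear R _ _ _ 1 n (n + 1) (add_comm 1 n) s.shortExact.extClass

/-- The covariant connecting map. -/
def postδ (X : Type u) [AddCommGroup X] [Module R X] (n : ℕ) :
    E R X D n →ₗ[R] E R X A (n + 1) :=
  (Abelian.Ext.bilinearCompOfLinear R _ _ _ n 1 (n + 1) rfl).flip s.shortExact.extClass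

lemma preδ_apply (n : ℕ) (x : E R A Y n) :
    s.preδ Y n x = s.shortExact.extClass.comp x (add_comm 1 n) := rfl

lemma postδ_apply (n : ℕ) (x : E R X D n) :
    s.postδ X n x = x.comp s.shortExact.extClass rfl := rfl

lemma pre_postδ {X' : Type u} [AddCommGroup X'] [Module R X'] (n : ℕ) (h : X' →ₗ[R] X)
    (x : E R X D n) : pre (n + 1) h A (s.postδ X n x) = s.postδ X' n (pre n h D x) := by
  simp only [pre_apply, postδ_apply]
  exact (Abelian.Ext.comp_assoc _ _ _ _ _ (by omega)).symm

include s in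
lemma pre_exact (n : ℕ) : Function.Exact (pre n g Y) (pre n f Y) := by
  intro x
  constructor
  · intro h
    exact Abelian.Ext.contravariant_sequence_exact₂ s.shortExact _ x h
  · rintro ⟨y, rfl⟩
    rw [pre_pre, s.comp_eq_zero, pre_zero]

lemma preδ_exact (n : ℕ) : Function.Exact (pre n f Y) (s.preδ Y n) := by
  intro x
  constructor
  · intro h
    exact Abelian.Ext.contravariant_sequence_exact₁ s.shortExact _ x (add_comm 1 n) h
  · rintro ⟨y, rfl⟩
    rw [pre_apply, preδ_apply]
    exact s.shortExact.extClass_comp_assoc _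

lemma exact_preδ (n : ℕ) : Function.Exact (s.preδ Y n) (pre (n + 1) g Y) := by
  intro x
  constructor
  · intro h
    exact Abelian.Ext.contravariant_sequence_exact₃ s.shortExact _ x h (add_comm 1 n)
  · rintro ⟨y, rfl⟩
    rw [pre_apply, preδ_apply]
    exact s.shortExact.comp_extClass_assoc _ _

include s in
lemma post_exact (n : ℕ) : Function.Exact (post n X f) (post n X g) := by
  intro x
  constructor
  · intro h
    exact Abelian.Ext.covariant_sequence_exact₂ _ s.shortExact x h
  · rintro ⟨y, rfl⟩
    rw [post_post, s.comp_eq_zero, post_zero]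

lemma postδ_exact (n : ℕ) : Function.Exact (post n X g) (s.postδ X n) := by
  intro x
  constructor
  · intro h
    exact Abelian.Ext.covariant_sequence_exact₃ _ s.shortExact x rfl h
  · rintro ⟨y, rfl⟩
    rw [post_apply, postδ_apply]
    have h := s.shortExact.comp_extClass
    rw [Abelian.Ext.comp_assoc_of_second_deg_zero]
    erw [h]
    exact Abelian.Ext.comp_zero _ _ _ _ _

lemma exact_postδ (n : ℕ) : Function.Exact (s.postδ X n) (post (n + 1) X f) := by
  intro x
  constructor
  · intro h
    exact Abelian.Ext.covariant_sequence_exact₁ _ s.shortExact x h rfl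
  · rintro ⟨y, rfl⟩
    rw [post_apply, postδ_apply]
    have h := s.shortExact.extClass_comp
    rw [Abelian.Ext.comp_assoc_of_third_deg_zero]
    erw [h]
    exact Abelian.Ext.comp_zero _ _ _ _ _

end SES

end ModExt

namespace LocalCoh

open Limits Opposite ModExt

variable {R : Type u} [CommRing R] (J : Ideal R)

/-- The transition maps `R ⧸ J ^ n' → R ⧸ J ^ n`. -/
abbrev trans {n n' : ℕ} (h : n ≤ n') : (R ⧸ J ^ n') →ₗ[R] (R ⧸ J ^ n) :=
  Submodule.mapQ (J ^ n') (J ^ n) LinearMap.id (Ideal.pow_le_pow_right h)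

/-- The directed system defining local cohomology. -/
abbrev diag (i : ℕ) : ℕᵒᵖᵒᵖ ⥤ ModuleCat.{u} R ⥤ ModuleCat.{u} R :=
  localCohomology.diagram (localCohomology.idealPowersDiagram J) i

instance (i : ℕ) : HasColimit (diag J i) := localCohomology.hasColimitDiagram.{u, 0} _ i

/-- The directed system evaluated at a module. -/
abbrev evalDiag (i : ℕ) (A : ModuleCat.{u} R) : ℕᵒᵖᵒᵖ ⥤ ModuleCat.{u} R :=
  diag J i ⋙ (evaluation _ _).obj A

/-- The colimit cocone evaluated at a module. -/
abbrev evalCocone (i : ℕ) (A : ModuleCat.{u} R) : Cocone (evalDiag J i A) :=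
  ((evaluation _ _).obj A).mapCocone (colimit.cocone (diag J i))

def evalIsColimit (i : ℕ) (A : ModuleCat.{u} R) : IsColimit (evalCocone J i A) :=
  isColimitOfPreserves _ (colimit.isColimit (diag J i))

instance : PreservesFilteredColimitsOfSize.{0, 0} (forget (ModuleCat.{u} R)) :=
  preservesFilteredColimitsOfSize_shrink.{0, u, 0, u} _

variable {A B D : Type u} [AddCommGroup A] [Module R A] [AddCommGroup B] [Module R B]
  [AddCommGroup D] [Module R D]

/-- The structure maps of the colimit defining local cohomology. -/
def iotaHom (n i : ℕ) (A : Type u) [AddCommGroup A] [Module R A] :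
    ExtComparison.extObj i (ModuleCat.of R (R ⧸ J ^ n)) (ModuleCat.of R A) ⟶
      (localCohomology J i).obj (ModuleCat.of R A) :=
  (evalCocone J i (ModuleCat.of R A)).ι.app (op (op n))

/-- The maps from the `Ext` groups to the local cohomology. -/
def iota (n i : ℕ) (A : Type u) [AddCommGroup A] [Module R A] :
    E R (R ⧸ J ^ n) A i →ₗ[R] Paper.LocCoh R J i A :=
  (iotaHom J n i A).hom ∘ₗ
    (ExtComparison.extEquiv i (ModuleCat.of R (R ⧸ J ^ n)) (ModuleCat.of R A)).symm.toLinearMap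

lemma evalDiag_map {n n' : ℕ} (h : n ≤ n') (i : ℕ)
    (f : op (op n) ⟶ op (op n')) (x : E R (R ⧸ J ^ n) A i) :
    (evalDiag J i (ModuleCat.of R A)).map f
      ((ExtComparison.extEquiv i (ModuleCat.of R (R ⧸ J ^ n)) (ModuleCat.of R A)).symm x) =
    (ExtComparison.extEquiv i (ModuleCat.of R (R ⧸ J ^ n')) (ModuleCat.of R A)).symm
      (pre i (trans J h) A x) :=
  (LinearEquiv.eq_symm_apply _).2
    ((ExtComparison.extEquiv_precomp i (ModuleCat.ofHom (trans J h)) (ModuleCat.of R A) _).trans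
      (by rw [LinearEquiv.apply_symm_apply]; rfl))

lemma iota_pre {n n' : ℕ} (h : n ≤ n') (i : ℕ) (x : E R (R ⧸ J ^ n) A i) :
    iota J n' i A (pre i (trans J h) A x) = iota J n i A x := by
  let f : op (op n) ⟶ op (op n') := (homOfLE h).op.op
  have h1 := evalDiag_map J h i f x
  have h2 := congrArg (fun z => z ((ExtComparison.extEquiv i (ModuleCat.of R (R ⧸ J ^ n))
    (ModuleCat.of R A)).symm x)) ((evalCocone J i (ModuleCat.of R A)).w f)
  exact (congrArg (fun z => iotaHom J n' i A z) h1).symm.trans h2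

lemma exists_iota (i : ℕ) (x : Paper.LocCoh R J i A) :
    ∃ (n : ℕ) (y : E R (R ⧸ J ^ n) A i), iota J n i A y = x := by
  obtain ⟨j, y, hy⟩ := Concrete.isColimit_exists_rep (evalDiag J i (ModuleCat.of R A))
    (evalIsColimit J i (ModuleCat.of R A)) x
  refine ⟨j.unop.unop, ExtComparison.extEquiv i _ _ y, ?_⟩
  exact (congrArg (iotaHom J j.unop.unop i A) (LinearEquiv.symm_apply_apply _ _)).trans hy

lemma iota_eq_zero {n i : ℕ} (x : E R (R ⧸ J ^ n) A i) (hx : iota J n i A x = 0) :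
    ∃ (n' : ℕ) (h : n ≤ n'), pre i (trans J h) A x = 0 := by
  have h0 : iota J n i A x = iota J n i A 0 := by rw [hx, map_zero]
  obtain ⟨k, f, g, hk⟩ := Concrete.isColimit_exists_of_rep_eq (evalDiag J i (ModuleCat.of R A))
    (evalIsColimit J i (ModuleCat.of R A)) _ _ h0
  have hn : n ≤ k.unop.unop := leOfHom f.unop.unop
  refine ⟨k.unop.unop, hn, ?_⟩
  have h1 := evalDiag_map J hn i f x
  have h2 := evalDiag_map J hn i g (0 : E R (R ⧸ J ^ n) A i)
  exact ((LinearEquiv.injective _) (h1.symm.trans (hk.trans h2))).trans (map_zero _)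

/-- The cocone attached to a compatible family of maps out of the `Ext` groups. -/
def descCocone (i : ℕ) {N : Type u} [AddCommGroup N] [Module R N]
    (φ : ∀ n, E R (R ⧸ J ^ n) A i →ₗ[R] N)
    (hφ : ∀ n n' (h : n ≤ n') x, φ n' (pre i (trans J h) A x) = φ n x) :
    Cocone (evalDiag J i (ModuleCat.of R A)) where
  pt := ModuleCat.of R N
  ι :=
    { app := fun j => ModuleCat.ofHom (φ j.unop.unop ∘ₗ
        (ExtComparison.extEquiv i (ModuleCat.of R (R ⧸ J ^ j.unop.unop))
          (ModuleCat.of R A)).toLinearMap)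
      naturality := fun j k f => by
        ext y
        obtain ⟨x, rfl⟩ := (ExtComparison.extEquiv i (ModuleCat.of R (R ⧸ J ^ j.unop.unop))
          (ModuleCat.of R A)).symm.surjective y
        have h1 := evalDiag_map J (leOfHom f.unop.unop) i f x
        have h2 := congrArg (fun z => φ k.unop.unop (ExtComparison.extEquiv i
          (ModuleCat.of R (R ⧸ J ^ k.unop.unop)) (ModuleCat.of R A) z)) h1
        refine h2.trans ?_
        simp only [LinearEquiv.apply_symm_apply]
        rw [hφ]
        exact (congrArg (φ j.unop.unop) (LinearEquiv.apply_symm_apply _ _)).symm }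

/-- The universal property of local cohomology. -/
def desc (i : ℕ) {N : Type u} [AddCommGroup N] [Module R N]
    (φ : ∀ n, E R (R ⧸ J ^ n) A i →ₗ[R] N)
    (hφ : ∀ n n' (h : n ≤ n') x, φ n' (pre i (trans J h) A x) = φ n x) :
    Paper.LocCoh R J i A →ₗ[R] N :=
  ((evalIsColimit J i (ModuleCat.of R A)).desc (descCocone J i φ hφ)).hom

lemma desc_iota (i : ℕ) {N : Type u} [AddCommGroup N] [Module R N]
    (φ : ∀ n, E R (R ⧸ J ^ n) A i →ₗ[R] N)
    (hφ : ∀ n n' (h : n ≤ n') x, φ n' (pre i (trans J h) A x) = φ n x)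
    (n : ℕ) (x : E R (R ⧸ J ^ n) A i) :
    desc J i φ hφ (iota J n i A x) = φ n x := by
  have h := congrArg (fun z => z.hom ((ExtComparison.extEquiv i (ModuleCat.of R (R ⧸ J ^ n))
    (ModuleCat.of R A)).symm x)) ((evalIsColimit J i (ModuleCat.of R A)).fac
    (descCocone J i φ hφ) (op (op n)))
  refine h.trans ?_
  exact congrArg (φ n) (LinearEquiv.apply_symm_apply _ _)

end LocalCoh

namespace LocalCoh

open ModExt

variable {R : Type u} [CommRing R] (J : Ideal R)

variable {A B D : Type u} [AddCommGroup A] [Module R A] [AddCommGroup B] [Module R B]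
  [AddCommGroup D] [Module R D]

/-- The map on local cohomology induced by a compatible family of maps on `Ext`. -/
def familyMap {i j : ℕ} (φ : ∀ n, E R (R ⧸ J ^ n) A i →ₗ[R] E R (R ⧸ J ^ n) B j)
    (hφ : ∀ n n' (h : n ≤ n') x, φ n' (pre i (trans J h) A x) = pre j (trans J h) B (φ n x)) :
    Paper.LocCoh R J i A →ₗ[R] Paper.LocCoh R J j B :=
  desc J i (fun n => iota J n j B ∘ₗ φ n) (fun n n' h x =>
    (congrArg (iota J n' j B) (hφ n n' h x)).trans (iota_pre J h j (φ n x)))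

lemma familyMap_iota {i j : ℕ} (φ : ∀ n, E R (R ⧸ J ^ n) A i →ₗ[R] E R (R ⧸ J ^ n) B j)
    (hφ : ∀ n n' (h : n ≤ n') x, φ n' (pre i (trans J h) A x) = pre j (trans J h) B (φ n x))
    (n : ℕ) (x : E R (R ⧸ J ^ n) A i) :
    familyMap J φ hφ (iota J n i A x) = iota J n j B (φ n x) :=
  desc_iota J i _ _ n x

lemma familyMap_exact {i j k : ℕ}
    (φ : ∀ n, E R (R ⧸ J ^ n) A i →ₗ[R] E R (R ⧸ J ^ n) B j)
    (hφ : ∀ n n' (h : n ≤ n') x, φ n' (pre i (trans J h) A x) = pre j (trans J h) B (φ n x))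
    (ψ : ∀ n, E R (R ⧸ J ^ n) B j →ₗ[R] E R (R ⧸ J ^ n) D k)
    (hψ : ∀ n n' (h : n ≤ n') x, ψ n' (pre j (trans J h) B x) = pre k (trans J h) D (ψ n x))
    (hex : ∀ n, Function.Exact (φ n) (ψ n)) :
    Function.Exact (familyMap J φ hφ) (familyMap J ψ hψ) := by
  intro x
  constructor
  · intro hx
    obtain ⟨n, y, rfl⟩ := exists_iota J j x
    rw [familyMap_iota] at hx
    obtain ⟨n', h, h0⟩ := iota_eq_zero J _ hx
    rw [← hψ] at h0
    obtain ⟨z, hz⟩ := (hex n' _).1 h0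
    exact ⟨iota J n' i A z, (familyMap_iota J φ hφ n' z).trans
      ((congrArg _ hz).trans (iota_pre J h j y))⟩
  · rintro ⟨y, rfl⟩
    obtain ⟨n, z, rfl⟩ := exists_iota J i y
    rw [familyMap_iota, familyMap_iota, (hex n _).2 ⟨z, rfl⟩, map_zero]

/-- Functoriality of local cohomology. -/
def Hmap (i : ℕ) (f : A →ₗ[R] B) : Paper.LocCoh R J i A →ₗ[R] Paper.LocCoh R J i B :=
  familyMap J (fun n => post i (R ⧸ J ^ n) f) (fun _ _ _ _ => (pre_post _ _ _ _).symm)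

lemma Hmap_iota (i n : ℕ) (f : A →ₗ[R] B) (x : E R (R ⧸ J ^ n) A i) :
    Hmap J i f (iota J n i A x) = iota J n i B (post i _ f x) :=
  familyMap_iota J _ _ n x

lemma Hmap_Hmap (i : ℕ) (f : A →ₗ[R] B) (g : B →ₗ[R] D) (x : Paper.LocCoh R J i A) :
    Hmap J i g (Hmap J i f x) = Hmap J i (g ∘ₗ f) x := by
  obtain ⟨n, y, rfl⟩ := exists_iota J i x
  rw [Hmap_iota, Hmap_iota, Hmap_iota, post_post]

lemma Hmap_id (i : ℕ) (x : Paper.LocCoh R J i A) : Hmap J i LinearMap.id x = x := by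
  obtain ⟨n, y, rfl⟩ := exists_iota J i x
  rw [Hmap_iota, post_id]

lemma Hmap_smul_id (i : ℕ) (r : R) (x : Paper.LocCoh R J i A) :
    Hmap J i (r • LinearMap.id : A →ₗ[R] A) x = r • x := by
  obtain ⟨n, y, rfl⟩ := exists_iota J i x
  rw [Hmap_iota, post_smul_id, map_smul]

lemma Hmap_zero (i : ℕ) (x : Paper.LocCoh R J i A) : Hmap J i (0 : A →ₗ[R] B) x = 0 := by
  obtain ⟨n, y, rfl⟩ := exists_iota J i x
  rw [Hmap_iota, post_zero, map_zero]

/-- Isomorphism invariance of local cohomology. -/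
def Hequiv (i : ℕ) (e : A ≃ₗ[R] B) : Paper.LocCoh R J i A ≃ₗ[R] Paper.LocCoh R J i B :=
  LinearEquiv.ofLinearMap (Hmap J i e.toLinearMap) (Hmap J i e.symm.toLinearMap)
    (LinearMap.ext fun x => (Hmap_Hmap J i _ _ x).trans (by simp [Hmap_id]))
    (LinearMap.ext fun x => (Hmap_Hmap J i _ _ x).trans (by simp [Hmap_id]))

section LES

variable {f : A →ₗ[R] B} {g : B →ₗ[R] D} (s : SES f g)

/-- The connecting map in local cohomology. -/
def Hδ (i : ℕ) : Paper.LocCoh R J i D →ₗ[R] Paper.LocCoh R J (i + 1) A :=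
  familyMap J (fun n => s.postδ (R ⧸ J ^ n) i) (fun _ _ _ _ => (s.pre_postδ _ _ _).symm)

include s in
lemma Hmap_exact (i : ℕ) : Function.Exact (Hmap J i f) (Hmap J i g) :=
  familyMap_exact J _ _ _ _ fun _ => s.post_exact i

lemma Hδ_exact (i : ℕ) : Function.Exact (Hmap J i g) (Hδ J s i) :=
  familyMap_exact J _ _ _ _ fun _ => s.postδ_exact i

lemma exact_Hδ (i : ℕ) : Function.Exact (Hδ J s i) (Hmap J (i + 1) f) :=
  familyMap_exact J _ _ _ _ fun _ => s.exact_postδ i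

end LES

lemma Hmap_zero_injective (f : A →ₗ[R] B) (hf : Function.Injective f) :
    Function.Injective (Hmap J 0 f) := by
  rw [injective_iff_map_eq_zero]
  intro x hx
  obtain ⟨n, y, rfl⟩ := exists_iota J 0 x
  rw [Hmap_iota] at hx
  obtain ⟨n', h, h0⟩ := iota_eq_zero J _ hx
  rw [pre_post] at h0
  rw [← iota_pre J h, post_zero_injective f hf (h0.trans (map_zero _).symm), map_zero]

lemma smul_eq_zero_of_forall (i : ℕ) (r : R) (h : ∀ x : A, r • x = 0)
    (x : Paper.LocCoh R J i A) : r • x = 0 := by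
  rw [← Hmap_smul_id, show (r • LinearMap.id : A →ₗ[R] A) = 0 from LinearMap.ext h, Hmap_zero]

lemma subsingleton_of_ext (i : ℕ) (h : ∀ n, Subsingleton (E R (R ⧸ J ^ n) A i)) :
    Subsingleton (Paper.LocCoh R J i A) := by
  refine subsingleton_of_forall_eq 0 fun x => ?_
  obtain ⟨n, y, rfl⟩ := exists_iota J i x
  rw [Subsingleton.elim y 0, map_zero]

lemma subsingleton_of_injective' [Module.Injective R A] (i : ℕ) :
    Subsingleton (Paper.LocCoh R J (i + 1) A) :=
  subsingleton_of_ext J _ fun _ => subsingleton_of_injective i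

/-- Evaluation identifies `H⁰` with the torsion submodule. -/
def ev (A : Type u) [AddCommGroup A] [Module R A] : Paper.LocCoh R J 0 A →ₗ[R] A :=
  desc J 0 (fun n => (LinearMap.applyₗ (Submodule.mkQ (J ^ n) 1)) ∘ₗ
    (homEquiv (R ⧸ J ^ n) A).toLinearMap) (fun n n' h x => by
      simp only [LinearMap.comp_apply, LinearEquiv.coe_coe, homEquiv_pre]; rfl)

lemma ev_iota (n : ℕ) (x : E R (R ⧸ J ^ n) A 0) :
    ev J A (iota J n 0 A x) = homEquiv _ _ x (Submodule.mkQ (J ^ n) 1) :=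
  desc_iota J 0 _ _ n x

lemma ev_Hmap (f : A →ₗ[R] B) (x : Paper.LocCoh R J 0 A) :
    ev J B (Hmap J 0 f x) = f (ev J A x) := by
  obtain ⟨n, y, rfl⟩ := exists_iota J 0 x
  rw [Hmap_iota, ev_iota, ev_iota, homEquiv_post]
  rfl

lemma ev_injective : Function.Injective (ev J A) := by
  rw [injective_iff_map_eq_zero]
  intro x hx
  obtain ⟨n, y, rfl⟩ := exists_iota J 0 x
  rw [ev_iota] at hx
  have : homEquiv _ _ y = 0 := by
    apply Submodule.linearMap_qext
    apply LinearMap.ext_ring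
    simpa using hx
  rw [(LinearEquiv.map_eq_zero_iff _).1 this, map_zero]

/-- The torsion submodule with respect to an ideal. -/
def gam (A : Type u) [AddCommGroup A] [Module R A] : Submodule R A where
  carrier := {x | ∃ k, ∀ r ∈ J ^ k, r • x = 0}
  zero_mem' := ⟨0, by simp⟩
  add_mem' := by
    rintro x y ⟨k, hk⟩ ⟨l, hl⟩
    refine ⟨max k l, fun r hr => ?_⟩
    rw [smul_add, hk r (Ideal.pow_le_pow_right (le_max_left _ _) hr),
      hl r (Ideal.pow_le_pow_right (le_max_right _ _) hr), add_zero]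
  smul_mem' := by
    rintro c x ⟨k, hk⟩
    exact ⟨k, fun r hr => by rw [smul_comm, hk r hr, smul_zero]⟩

lemma mem_gam {x : A} : x ∈ gam J A ↔ ∃ k, ∀ r ∈ J ^ k, r • x = 0 := Iff.rfl

lemma exists_ev {x : A} (hx : x ∈ gam J A) : ∃ y, ev J A y = x := by
  obtain ⟨k, hk⟩ := hx
  refine ⟨iota J k 0 A ((homEquiv _ _).symm (Submodule.liftQ (J ^ k)
    (LinearMap.toSpanSingleton R A x) (fun r hr => hk r hr))), ?_⟩
  rw [ev_iota, LinearEquiv.apply_symm_apply]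
  exact (Submodule.liftQ_apply _ _ _).trans (one_smul R x)

lemma ev_mem (x : Paper.LocCoh R J 0 A) : ev J A x ∈ gam J A := by
  obtain ⟨n, y, rfl⟩ := exists_iota J 0 x
  refine ⟨n, fun r hr => ?_⟩
  rw [ev_iota, ← map_smul, ← map_smul, smul_eq_mul, mul_one]
  have : Submodule.mkQ (J ^ n) r = 0 := (Submodule.Quotient.mk_eq_zero _).2 hr
  rw [this, map_zero]

lemma H0_subsingleton (h : gam J A = ⊥) : Subsingleton (Paper.LocCoh R J 0 A) := by
  refine subsingleton_of_forall_eq 0 fun x => ev_injective J ?_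
  have := ev_mem J x
  rw [h] at this
  rw [map_zero]
  simpa using this

/-- `H⁰` of a torsion module. -/
def evEquiv (h : gam J A = ⊤) : Paper.LocCoh R J 0 A ≃ₗ[R] A :=
  LinearEquiv.ofBijective (ev J A)
    ⟨ev_injective J, fun _ => exists_ev J (h ▸ Submodule.mem_top)⟩

lemma gam_injective [IsNoetherianRing R] (Q : Type u) [AddCommGroup Q] [Module R Q]
    [Module.Injective R Q] : Module.Injective R (gam J Q) := by
  apply Module.Baer.injective
  intro a g
  obtain ⟨l, hl⟩ : ∃ l, ∀ r ∈ J ^ l, ∀ z : a, r • g z = 0 := by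
    obtain ⟨S, hS⟩ := (IsNoetherian.noetherian (⊤ : Submodule R a))
    choose k hk using fun y : a => (g y).2
    refine ⟨S.sup k, fun r hr z => ?_⟩
    have hx : z ∈ Submodule.span R (S : Set a) := hS ▸ Submodule.mem_top
    induction hx using Submodule.span_induction with
    | mem x hx => exact Subtype.ext (hk x r (Ideal.pow_le_pow_right (Finset.le_sup hx) hr))
    | zero => simp
    | add x y _ _ h1 h2 => rw [map_add, smul_add, h1, h2, add_zero]
    | smul c x _ h => rw [map_smul, smul_comm, h, smul_zero]
  obtain ⟨n, hn⟩ : ∃ n, J ^ n ⊓ a ≤ J ^ l * a := by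
    obtain ⟨k, hk⟩ := Ideal.exists_pow_inf_eq_pow_smul J (M := R) a
    refine ⟨l + k, ?_⟩
    have h1 := hk (l + k) (by omega)
    simp only [smul_eq_mul, Ideal.mul_top, add_tsub_cancel_right] at h1
    rw [h1]
    exact Ideal.mul_mono_right inf_le_right
  have hker : ∀ x : a, (x : R) ∈ J ^ n → g x = 0 := by
    intro x hx
    have h1 : x ∈ (J ^ l) • (⊤ : Submodule R a) := by
      have := hn ⟨hx, x.2⟩
      rw [← smul_eq_mul] at this
      rw [Submodule.mem_smul_top_iff]
      exact this
    have h2 : J ^ l • (⊤ : Submodule R a) ≤ LinearMap.ker g :=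
      Submodule.smul_le.2 fun r hr y _ => by rw [LinearMap.mem_ker, map_smul, hl r hr]
    exact h2 h1
  let K : Submodule R a := Submodule.comap a.subtype (J ^ n)
  let φ : (a ⧸ K) →ₗ[R] R ⧸ J ^ n := Submodule.mapQ K (J ^ n) a.subtype le_rfl
  have hφ : Function.Injective φ := by
    rw [← LinearMap.ker_eq_bot]
    exact Submodule.ker_liftQ_eq_bot _ _ _ (by rw [LinearMap.ker_comp, Submodule.ker_mkQ])
  obtain ⟨h, hh⟩ := Module.Injective.out (Q := Q) φ hφ
    (Submodule.liftQ K ((gam J Q).subtype ∘ₗ g) (fun x hx => by simp [hker x hx]))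
  refine ⟨LinearMap.codRestrict (gam J Q) (h ∘ₗ Submodule.mkQ (J ^ n)) fun r => ⟨n, fun t ht => ?_⟩,
    fun x hx => Subtype.ext ?_⟩
  · rw [← map_smul]
    have : t • r ∈ J ^ n := Ideal.mul_mem_right _ _ ht
    rw [LinearMap.comp_apply, show Submodule.mkQ (J ^ n) (t • r) = 0 from
      (Submodule.Quotient.mk_eq_zero _).2 this, map_zero]
  · exact hh (Submodule.Quotient.mk ⟨x, hx⟩)

/-- Every module embeds into an injective one. -/
lemma exists_injective (A : Type u) [AddCommGroup A] [Module R A] :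
    ∃ (Q : ModuleCat.{u} R) (f : A →ₗ[R] Q), Module.Injective R Q ∧ Function.Injective f :=
  ⟨Injective.under (ModuleCat.of R A), (Injective.ι (ModuleCat.of R A)).hom,
    @Module.injective_module_of_injective_object R _ _ _ _ (Injective.injective_under (ModuleCat.of R A)),
    (ModuleCat.mono_iff_injective _).1 inferInstance⟩

/-- The short exact sequence of an injective map. -/
lemma SES_of_injective (f : A →ₗ[R] B) (hf : Function.Injective f) :
    SES f (LinearMap.range f).mkQ where
  inj := hf
  exact := LinearMap.exact_map_mkQ_range f
  surj := Submodule.mkQ_surjective _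

/-- The short exact sequence of a surjective map. -/
lemma SES_of_surjective (g : B →ₗ[R] D) (hg : Function.Surjective g) :
    SES (LinearMap.ker g).subtype g where
  inj := Submodule.subtype_injective _
  exact := LinearMap.exact_subtype_ker_map g
  surj := hg

lemma gam_eq_top_iff : gam J A = ⊤ ↔ ∀ x : A, ∃ k, ∀ r ∈ J ^ k, r • x = 0 :=
  ⟨fun h _ => (mem_gam J).1 (h ▸ Submodule.mem_top), fun h => eq_top_iff.2 fun x _ => h x⟩

lemma gam_eq_top_of_surjective (f : A →ₗ[R] B) (hf : Function.Surjective f) (h : gam J A = ⊤) :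
    gam J B = ⊤ := by
  rw [gam_eq_top_iff] at h ⊢
  intro y
  obtain ⟨x, rfl⟩ := hf y
  obtain ⟨k, hk⟩ := h x
  exact ⟨k, fun r hr => by rw [← map_smul, hk r hr, map_zero]⟩

lemma exists_injective_torsion [IsNoetherianRing R] (A : Type u) [AddCommGroup A] [Module R A]
    (hA : gam J A = ⊤) : ∃ (Q : ModuleCat.{u} R) (f : A →ₗ[R] Q), Module.Injective R Q ∧
      Function.Injective f ∧ gam J Q = ⊤ := by
  obtain ⟨Q, f, hQ, hf⟩ := exists_injective (R := R) A
  rw [gam_eq_top_iff] at hA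
  refine ⟨ModuleCat.of R (gam J Q), f.codRestrict _ fun x => ?_, gam_injective J Q, ?_, ?_⟩
  · obtain ⟨k, hk⟩ := hA x
    exact ⟨k, fun r hr => by rw [← map_smul, hk r hr, map_zero]⟩
  · exact fun x y h => hf (congrArg Subtype.val h)
  · exact (gam_eq_top_iff J).2 fun x => x.2.imp fun k hk r hr => Subtype.ext (hk r hr)

lemma subsingleton_of_torsion [IsNoetherianRing R] (i : ℕ) :
    ∀ (A : Type u) [AddCommGroup A] [Module R A], gam J A = ⊤ →
      Subsingleton (Paper.LocCoh R J (i + 1) A) := by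
  induction i with
  | zero =>
    intro A _ _ hA
    obtain ⟨Q, f, hQ, hf, hT⟩ := exists_injective_torsion J A hA
    have s := SES_of_injective f hf
    have := subsingleton_of_injective' J (A := Q) 0
    refine subsingleton_of_forall_eq 0 fun x => ?_
    obtain ⟨y, rfl⟩ := (exact_Hδ J s 0 x).1 (Subsingleton.elim _ _)
    rw [Hδ_exact J s 0]
    obtain ⟨q, hq⟩ := s.surj (ev J _ y)
    obtain ⟨z, rfl⟩ := (evEquiv J hT).surjective q
    exact ⟨z, ev_injective J ((ev_Hmap J _ z).trans hq)⟩
  | succ i ih =>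
    intro A _ _ hA
    obtain ⟨Q, f, hQ, hf, hT⟩ := exists_injective_torsion J A hA
    have s := SES_of_injective f hf
    have := subsingleton_of_injective' J (A := Q) (i + 1)
    have := ih _ (gam_eq_top_of_surjective J _ s.surj hT)
    refine subsingleton_of_forall_eq 0 fun x => ?_
    obtain ⟨y, rfl⟩ := (exact_Hδ J s (i + 1) x).1 (Subsingleton.elim _ _)
    rw [Subsingleton.elim y 0, map_zero]

end LocalCoh

namespace LocalCoh

open ModExt

variable {R : Type u} [CommRing R]

section Bdd

variable (J : Ideal R) {A B D : Type*} [AddCommGroup A] [Module R A] [AddCommGroup B] [Module R B]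
  [AddCommGroup D] [Module R D]

/-- Modules annihilated by a power of an ideal. -/
def Bdd (A : Type*) [AddCommGroup A] [Module R A] : Prop := ∃ k, ∀ r ∈ J ^ k, ∀ x : A, r • x = 0

variable {J}

lemma Bdd.of_subsingleton [Subsingleton A] : Bdd J A := ⟨0, fun _ _ _ => Subsingleton.elim _ _⟩

lemma Bdd.of_exact {f : A →ₗ[R] B} {g : B →ₗ[R] D} (h : Function.Exact f g)
    (hA : Bdd J A) (hD : Bdd J D) : Bdd J B := by
  obtain ⟨k, hk⟩ := hA
  obtain ⟨l, hl⟩ := hD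
  refine ⟨k + l, fun r hr x => ?_⟩
  rw [pow_add] at hr
  induction hr using Submodule.mul_induction_on' with
  | mem_mul_mem r hr s hs =>
    obtain ⟨a, ha⟩ := (h (s • x)).1 (by rw [map_smul, hl s hs])
    rw [mul_smul, ← ha, ← map_smul, hk r hr, map_zero]
  | add r _ s _ h1 h2 => rw [add_smul, h1, h2, add_zero]

lemma Bdd.of_injective (f : A →ₗ[R] B) (hf : Function.Injective f) (h : Bdd J B) : Bdd J A :=
  h.imp fun k hk r hr x => hf (by rw [map_smul, hk r hr, map_zero])

lemma Bdd.of_surjective (f : A →ₗ[R] B) (hf : Function.Surjective f) (h : Bdd J A) : Bdd J B :=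
  h.imp fun k hk r hr y => by
    obtain ⟨x, rfl⟩ := hf y
    rw [← map_smul, hk r hr, map_zero]

lemma Bdd.of_equiv (e : A ≃ₗ[R] B) (h : Bdd J A) : Bdd J B :=
  h.of_surjective e.toLinearMap e.surjective

lemma Bdd.quotient_pow (n : ℕ) : Bdd J (R ⧸ J ^ n) :=
  ⟨n, fun r hr x => by
    obtain ⟨y, rfl⟩ := Submodule.mkQ_surjective _ x
    rw [← map_smul]
    exact (Submodule.Quotient.mk_eq_zero _).2 (Ideal.mul_mem_right _ _ hr)⟩

lemma Bdd.quotient : Bdd J (R ⧸ J) :=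
  ⟨1, fun r hr x => by
    obtain ⟨y, rfl⟩ := Submodule.mkQ_surjective _ x
    rw [← map_smul]
    exact (Submodule.Quotient.mk_eq_zero _).2 (Ideal.mul_mem_right _ _ (pow_one J ▸ hr))⟩

end Bdd

section

variable {J : Ideal R} {A B : Type u} [AddCommGroup A] [Module R A] [AddCommGroup B] [Module R B]

lemma Bdd.gam_eq_top (h : Bdd J A) : gam J A = ⊤ :=
  (gam_eq_top_iff J).2 fun x => h.imp fun _ hk r hr => hk r hr x

lemma Bdd.locCoh (i : ℕ) (h : Bdd J A) : Bdd J (Paper.LocCoh R J i A) :=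
  h.imp fun _ hk r hr => smul_eq_zero_of_forall J i r (hk r hr)

lemma Bdd.ext_left (n : ℕ) (h : Bdd J A) : Bdd J (E R A B n) :=
  h.imp fun _ hk r hr x => by
    rw [← pre_smul_id, show (r • LinearMap.id : A →ₗ[R] A) = 0 from LinearMap.ext (hk r hr),
      pre_zero]

lemma Bdd.gam [IsNoetherianRing R] [Module.Finite R A] : Bdd J (gam J A) := by
  obtain ⟨S, hS⟩ := (IsNoetherian.noetherian (⊤ : Submodule R (LocalCoh.gam J A)))
  choose k hk using fun y : LocalCoh.gam J A => y.2
  refine ⟨S.sup k, fun r hr z => ?_⟩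
  have hx : z ∈ Submodule.span R (S : Set (LocalCoh.gam J A)) := hS ▸ Submodule.mem_top
  induction hx using Submodule.span_induction with
  | mem x hx => exact Subtype.ext (hk x r (Ideal.pow_le_pow_right (Finset.le_sup hx) hr))
  | zero => simp
  | add x y _ _ h1 h2 => rw [smul_add, h1, h2, add_zero]
  | smul c x _ h => rw [smul_comm, h, smul_zero]

lemma gam_quotient_gam [IsNoetherianRing R] [Module.Finite R A] :
    LocalCoh.gam J (A ⧸ LocalCoh.gam J A) = ⊥ := by
  rw [eq_bot_iff]
  intro x hx
  obtain ⟨y, rfl⟩ := Submodule.mkQ_surjective _ x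
  obtain ⟨k, hk⟩ := hx
  obtain ⟨l, hl⟩ := Bdd.gam (J := J) (A := A)
  refine (Submodule.Quotient.mk_eq_zero _).2 ⟨l + k, fun r hr => ?_⟩
  rw [pow_add] at hr
  induction hr using Submodule.mul_induction_on' with
  | mem_mul_mem r hr s hs =>
    have h1 : s • y ∈ LocalCoh.gam J A := by
      have := hk s hs
      rw [← map_smul] at this
      exact (Submodule.Quotient.mk_eq_zero _).1 this
    rw [mul_smul]
    exact congrArg Subtype.val (hl r hr ⟨_, h1⟩)
  | add r _ s _ h1 h2 => rw [add_smul, h1, h2, add_zero]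

end

lemma SES_submodule {A : Type u} [AddCommGroup A] [Module R A] (N : Submodule R A) :
    SES N.subtype N.mkQ where
  inj := N.subtype_injective
  exact := LinearMap.exact_subtype_mkQ N
  surj := N.mkQ_surjective

section Local

open IsLocalRing

variable [IsLocalRing R] [IsNoetherianRing R]

local notation "𝔪" => maximalIdeal R

lemma isFiniteLength_of_bdd (k : ℕ) : ∀ (A : Type u) [AddCommGroup A] [Module R A]
    [Module.Finite R A], (∀ r ∈ 𝔪 ^ k, ∀ x : A, r • x = 0) → IsArtinian R A := by
  induction k with
  | zero =>
    intro A _ _ _ h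
    have : Subsingleton A := subsingleton_of_forall_eq 0 fun x => by
      rw [← one_smul R x]; exact h 1 (by simp) x
    infer_instance
  | succ k ih =>
    intro A _ _ _ h
    rw [isArtinian_iff_submodule_quotient (𝔪 • (⊤ : Submodule R A))]
    constructor
    · apply ih
      rintro r hr ⟨x, hx⟩
      ext
      induction hx using Submodule.smul_induction_on' with
      | smul s hs y _ =>
        change r • s • y = 0
        rw [← mul_smul]
        exact h _ (by rw [pow_succ]; exact Ideal.mul_mem_mul hr hs) _
      | add y _ z _ h1 h2 =>
        change r • (y + z) = 0
        rw [smul_add]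
        exact (congrArg₂ (· + ·) h1 h2).trans (add_zero _)
    · have : IsArtinian (R ⧸ 𝔪) (A ⧸ (𝔪 • (⊤ : Submodule R A))) := by
        have : Module.Finite (R ⧸ 𝔪) (A ⧸ (𝔪 • (⊤ : Submodule R A))) :=
          Module.Finite.of_restrictScalars_finite R _ _
        let _ : Field (R ⧸ 𝔪) := Ideal.Quotient.field _
        infer_instance
      exact isArtinian_of_surjective_algebraMap (R := R ⧸ 𝔪) Ideal.Quotient.mk_surjective

lemma Bdd.isFiniteLength {A : Type u} [AddCommGroup A] [Module R A] [Module.Finite R A]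
    (h : Bdd 𝔪 A) : IsFiniteLength R A := by
  obtain ⟨k, hk⟩ := h
  rw [isFiniteLength_iff_isNoetherian_isArtinian]
  exact ⟨inferInstance, isFiniteLength_of_bdd k A hk⟩

omit [IsNoetherianRing R] in
lemma exists_equiv_of_isSimpleModule {A : Type*} [AddCommGroup A] [Module R A]
    [IsSimpleModule R A] : Nonempty (A ≃ₗ[R] R ⧸ 𝔪) := by
  obtain ⟨I, hI, ⟨e⟩⟩ := isSimpleModule_iff_quot_maximal.1 ‹IsSimpleModule R A›
  rw [IsLocalRing.eq_maximalIdeal hI] at e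
  exact ⟨e⟩

omit [IsNoetherianRing R] in
lemma bdd_of_isFiniteLength {A : Type u} [AddCommGroup A] [Module R A]
    (h : IsFiniteLength R A) : Bdd 𝔪 A := by
  induction h with
  | of_subsingleton => exact .of_subsingleton
  | @of_simple_quotient M _ _ N _ _ ih =>
    obtain ⟨e⟩ := exists_equiv_of_isSimpleModule (R := R) (A := M ⧸ N)
    exact .of_exact (f := N.subtype) (g := N.mkQ) (LinearMap.exact_subtype_mkQ N) ih
      (Bdd.quotient.of_equiv e.symm)

omit [IsNoetherianRing R] in
/-- Vanishing of `Ext` against finite length modules. -/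
lemma ext_subsingleton_of_isFiniteLength {A Y : Type u} [AddCommGroup A] [Module R A]
    [AddCommGroup Y] [Module R Y] (n : ℕ) (hY : Subsingleton (E R (R ⧸ 𝔪) Y n))
    (h : IsFiniteLength R A) : Subsingleton (E R A Y n) := by
  induction h with
  | @of_subsingleton M _ _ _ =>
    refine subsingleton_of_forall_eq 0 fun x => ?_
    rw [← pre_id n x, show (LinearMap.id : M →ₗ[R] M) = 0 from Subsingleton.elim _ _, pre_zero]
  | @of_simple_quotient M _ _ N _ _ ih =>
    obtain ⟨e⟩ := exists_equiv_of_isSimpleModule (R := R) (A := M ⧸ N)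
    have h1 : Subsingleton (E R (M ⧸ N) Y n) := (preEquiv n e Y).symm.subsingleton
    refine subsingleton_of_forall_eq 0 fun x => ?_
    obtain ⟨y, rfl⟩ := ((SES_submodule N).pre_exact n x).1 (Subsingleton.elim _ _)
    rw [Subsingleton.elim y 0, map_zero]

lemma locCoh_subsingleton {Y : Type u} [AddCommGroup Y] [Module R Y] (n : ℕ)
    (hY : Subsingleton (E R (R ⧸ 𝔪) Y n)) : Subsingleton (Paper.LocCoh R 𝔪 n Y) :=
  subsingleton_of_ext _ _ fun k => ext_subsingleton_of_isFiniteLength n hY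
    (Bdd.quotient_pow k).isFiniteLength

/-- Existence of regular elements in the maximal ideal. -/
lemma exists_regular {Z : Type u} [AddCommGroup Z] [Module R Z] [Module.Finite R Z]
    (h : gam 𝔪 Z = ⊥) : ∃ x ∈ 𝔪, IsSMulRegular Z x := by
  have h1 : Subsingleton ((R ⧸ 𝔪) →ₗ[R] Z) := by
    refine subsingleton_of_forall_eq 0 fun f => LinearMap.ext fun y => ?_
    have : f y ∈ gam 𝔪 Z := by
      obtain ⟨k, hk⟩ := Bdd.quotient (J := 𝔪)
      exact ⟨k, fun r hr => by rw [← map_smul, hk r hr, map_zero]⟩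
    rw [h] at this
    exact this
  obtain ⟨x, hx, hx'⟩ := IsSMulRegular.subsingleton_linearMap_iff.1 h1
  rw [Ideal.annihilator_quotient] at hx
  exact ⟨x, hx, hx'⟩

end Local

end LocalCoh

namespace LocalCoh

open ModExt

variable {R : Type u} [CommRing R]

section HomSES

variable {K F K' Y : Type u} [AddCommGroup K] [Module R K] [AddCommGroup F] [Module R F]
  [AddCommGroup K'] [Module R K'] [AddCommGroup Y] [Module R Y]
  {ι : K' →ₗ[R] F} {g : F →ₗ[R] K}

/-- Applying `Hom(-, Y)` to a short exact sequence. -/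
lemma SES_hom (s : SES ι g) (h : Subsingleton (E R K Y 1)) :
    SES (LinearMap.lcomp R Y g) (LinearMap.lcomp R Y ι) where
  inj := fun _ _ h => (LinearMap.cancel_right s.surj).1 h
  exact := by
    intro φ
    constructor
    · intro hφ
      have h1 : pre 0 ι Y ((homEquiv F Y).symm φ) = 0 := by
        apply (homEquiv K' Y).injective
        rw [homEquiv_pre, LinearEquiv.apply_symm_apply, map_zero]
        exact hφ
      obtain ⟨y, hy⟩ := (s.pre_exact 0 _).1 h1
      refine ⟨homEquiv K Y y, ?_⟩
      have := congrArg (homEquiv F Y) hy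
      rwa [homEquiv_pre, LinearEquiv.apply_symm_apply] at this
    · rintro ⟨ψ, rfl⟩
      change (ψ ∘ₗ g) ∘ₗ ι = 0
      rw [LinearMap.comp_assoc, s.comp_eq_zero, LinearMap.comp_zero]
  surj := by
    intro φ
    obtain ⟨y, hy⟩ := (s.preδ_exact (Y := Y) 0 ((homEquiv K' Y).symm φ)).1 (Subsingleton.elim _ _)
    refine ⟨homEquiv F Y y, ?_⟩
    have := congrArg (homEquiv K' Y) hy
    rwa [homEquiv_pre, LinearEquiv.apply_symm_apply] at this

/-- Dimension shifting along a projective cover. -/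
def SES_shift (s : SES ι g) [Module.Projective R F] (n : ℕ) :
    E R K' Y (n + 1) ≃ₗ[R] E R K Y (n + 2) :=
  LinearEquiv.ofBijective (s.preδ Y (n + 1)) (by
    have := subsingleton_of_projective (R := R) (A := F) (B := Y) n
    have := subsingleton_of_projective (R := R) (A := F) (B := Y) (n + 1)
    constructor
    · rw [injective_iff_map_eq_zero]
      intro x hx
      obtain ⟨y, rfl⟩ := (s.preδ_exact (n + 1) x).1 hx
      rw [Subsingleton.elim y 0, map_zero]
    · intro x
      exact (s.exact_preδ (n + 1) x).1 (Subsingleton.elim _ _))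

end HomSES

section Powers

variable (P : ∀ (M : Type u) [AddCommGroup M] [Module R M], Prop)

/-- Modules properties closed under extensions and direct summands pass to `Hom(F, -)` for
finitely generated projective `F`. -/
lemma hom_projective_induction
    (hz : ∀ (M : Type u) [AddCommGroup M] [Module R M] [Subsingleton M], P M)
    (he : ∀ (A B D : Type u) [AddCommGroup A] [Module R A] [AddCommGroup B] [Module R B]
      [AddCommGroup D] [Module R D] (f : A →ₗ[R] B) (g : B →ₗ[R] D), SES f g → P A → P D → P B)
    (hr : ∀ (A B : Type u) [AddCommGroup A] [Module R A] [AddCommGroup B] [Module R B]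
      (s : A →ₗ[R] B) (p : B →ₗ[R] A), p ∘ₗ s = LinearMap.id → P B → P A)
    (F Y : Type u) [AddCommGroup F] [Module R F] [Module.Finite R F] [Module.Projective R F]
    [AddCommGroup Y] [Module R Y] (hY : P Y) : P (F →ₗ[R] Y) := by
  have hpow : ∀ n : ℕ, P (Fin n → Y) := by
    intro n
    induction n with
    | zero => exact hz _
    | succ n ih =>
      refine he _ _ _ (LinearMap.single R (fun _ : Fin (n + 1) => Y) 0)
        (LinearMap.funLeft R Y Fin.succ) ⟨?_, ?_, ?_⟩ hY ih
      · exact fun x y h => by simpa using congrFun h 0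
      · intro x
        constructor
        · intro hx
          refine ⟨x 0, funext fun i => ?_⟩
          refine Fin.cases ?_ (fun i => ?_) i
          · simp
          · have := congrFun hx i
            simpa using this.symm
        · rintro ⟨y, rfl⟩
          ext i
          simp [LinearMap.funLeft_apply]
      · exact fun x => ⟨Fin.cons 0 x, by ext i; simp [LinearMap.funLeft_apply]⟩
  obtain ⟨n, g, hg⟩ := Module.Finite.exists_fin' R F
  obtain ⟨s, hs⟩ := Module.projective_lifting_property g LinearMap.id hg
  have hB : P ((Fin n → R) →ₗ[R] Y) :=
    hr _ _ ((Pi.basisFun R (Fin n)).constr R).symm.toLinearMap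
      ((Pi.basisFun R (Fin n)).constr R).toLinearMap (by ext; simp) (hpow n)
  refine hr _ _ (LinearMap.lcomp R Y g) (LinearMap.lcomp R Y s) ?_ hB
  ext φ x
  exact congrArg φ (LinearMap.congr_fun hs x)

end Powers

section Closure

variable (J : Ideal R) (F Y : Type u) [AddCommGroup F] [Module R F] [Module.Finite R F]
  [Module.Projective R F] [AddCommGroup Y] [Module R Y]

lemma ext_hom_projective (A : Type u) [AddCommGroup A] [Module R A] (n : ℕ)
    (h : Subsingleton (E R A Y n)) : Subsingleton (E R A (F →ₗ[R] Y) n) := by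
  refine hom_projective_induction (fun M [AddCommGroup M] [Module R M] => Subsingleton (E R A M n)) ?_ ?_ ?_ F Y h
  · intro M _ _ _
    refine subsingleton_of_forall_eq 0 fun x => ?_
    rw [← post_id n x, show (LinearMap.id : M →ₗ[R] M) = 0 from Subsingleton.elim _ _, post_zero]
  · intro A B D _ _ _ _ _ _ f g s hA hD
    refine subsingleton_of_forall_eq 0 fun x => ?_
    obtain ⟨y, rfl⟩ := (s.post_exact n x).1 (Subsingleton.elim _ _)
    rw [Subsingleton.elim y 0, map_zero]
  · intro A B _ _ _ _ s p h hB
    refine subsingleton_of_forall_eq 0 fun x => ?_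
    rw [← post_id n x, ← h, ← post_post, Subsingleton.elim (post n _ s x) 0, map_zero]

lemma bdd_locCoh_hom_projective (n : ℕ)
    (h : Bdd J (Paper.LocCoh R J n Y)) : Bdd J (Paper.LocCoh R J n (F →ₗ[R] Y)) := by
  refine hom_projective_induction (fun M [AddCommGroup M] [Module R M] => Bdd J (Paper.LocCoh R J n M)) ?_ ?_ ?_ F Y h
  · intro M _ _ _
    exact Bdd.locCoh n .of_subsingleton
  · intro A B D _ _ _ _ _ _ f g s hA hD
    exact .of_exact (Hmap_exact J s n) hA hD
  · intro A B _ _ _ _ s p h hB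
    refine hB.of_injective (Hmap J n s) (Function.LeftInverse.injective (g := Hmap J n p) ?_)
    intro x
    rw [Hmap_Hmap, h, Hmap_id]

lemma locCoh_hom_projective (n : ℕ) (h : Subsingleton (Paper.LocCoh R J n Y)) :
    Subsingleton (Paper.LocCoh R J n (F →ₗ[R] Y)) := by
  refine hom_projective_induction (fun M [AddCommGroup M] [Module R M] => Subsingleton (Paper.LocCoh R J n M)) ?_ ?_ ?_ F Y h
  · intro M _ _ _
    refine subsingleton_of_forall_eq 0 fun x => ?_
    rw [← Hmap_id J n x, show (LinearMap.id : M →ₗ[R] M) = 0 from Subsingleton.elim _ _, Hmap_zero]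
  · intro A B D _ _ _ _ _ _ f g s hA hD
    refine subsingleton_of_forall_eq 0 fun x => ?_
    obtain ⟨y, rfl⟩ := (Hmap_exact J s n x).1 (Subsingleton.elim _ _)
    rw [Subsingleton.elim y 0, map_zero]
  · intro A B _ _ _ _ s p h hB
    refine subsingleton_of_forall_eq 0 fun x => ?_
    rw [← Hmap_id J n x, ← h, ← Hmap_Hmap, Subsingleton.elim (Hmap J n s x) 0, map_zero]

end Closure

section Syzygy

/-- Existence of syzygies. -/
lemma exists_syzygy (K : Type u) [AddCommGroup K] [Module R K] [Module.Finite R K] :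
    ∃ (n : ℕ) (g : (Fin n → R) →ₗ[R] K), SES (LinearMap.ker g).subtype g :=
  let ⟨n, g, hg⟩ := Module.Finite.exists_fin' R K
  ⟨n, g, SES_of_surjective g hg⟩

variable [IsNoetherianRing R]

lemma bdd_locCoh_hom (J : Ideal R) (Y : Type u) [AddCommGroup Y] [Module R Y] (i : ℕ) :
    ∀ (K : Type u) [AddCommGroup K] [Module R K] [Module.Finite R K],
      (∀ j ≤ i, Bdd J (Paper.LocCoh R J j Y)) → (∀ j, Subsingleton (E R K Y (j + 1))) →
        Bdd J (Paper.LocCoh R J i (K →ₗ[R] Y)) := by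
  induction i with
  | zero =>
    intro K _ _ _ hY hK
    obtain ⟨n, g, s⟩ := exists_syzygy (R := R) K
    exact (bdd_locCoh_hom_projective J _ Y 0 (hY 0 le_rfl)).of_injective _
      (Hmap_zero_injective J _ (SES_hom s (hK 0)).inj)
  | succ i ih =>
    intro K _ _ _ hY hK
    obtain ⟨n, g, s⟩ := exists_syzygy (R := R) K
    refine .of_exact (exact_Hδ J (SES_hom s (hK 0)) i)
      (ih _ (fun j hj => hY j (by omega)) fun j => ?_)
      (bdd_locCoh_hom_projective J _ Y (i + 1) (hY _ le_rfl))
    have := hK (j + 1)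
    exact (SES_shift s j).subsingleton

lemma ext_hom (A : Type u) [AddCommGroup A] [Module R A]
    (Y : Type u) [AddCommGroup Y] [Module R Y] (i : ℕ) :
    ∀ (K : Type u) [AddCommGroup K] [Module R K] [Module.Finite R K],
      (∀ j ≤ i, Subsingleton (E R A Y j)) → (∀ j, Subsingleton (E R K Y (j + 1))) →
        Subsingleton (E R A (K →ₗ[R] Y) i) := by
  induction i with
  | zero =>
    intro K _ _ _ hY hK
    obtain ⟨n, g, s⟩ := exists_syzygy (R := R) K
    have := ext_hom_projective (Fin n → R) Y A 0 (hY 0 le_rfl)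
    exact (post_zero_injective (A := A) _ (SES_hom s (hK 0)).inj).subsingleton
  | succ i ih =>
    intro K _ _ _ hY hK
    obtain ⟨n, g, s⟩ := exists_syzygy (R := R) K
    have h1 := ih (LinearMap.ker g) (fun j hj => hY j (by omega)) fun j => by
      have := hK (j + 1)
      exact (SES_shift s j).subsingleton
    have h2 := ext_hom_projective (Fin n → R) Y A (i + 1) (hY _ le_rfl)
    refine subsingleton_of_forall_eq 0 fun x => ?_
    obtain ⟨y, rfl⟩ := ((SES_hom s (hK 0)).exact_postδ i x).1 (Subsingleton.elim _ _)
    rw [Subsingleton.elim y 0, map_zero]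

end Syzygy

section Semidualizing

lemma post_sum {A B B' : Type u} [AddCommGroup A] [Module R A] [AddCommGroup B] [Module R B]
    [AddCommGroup B'] [Module R B'] {κ : Type*} (S : Finset κ) (n : ℕ) (g : κ → B →ₗ[R] B')
    (x : E R A B n) : post n A (∑ i ∈ S, g i) x = ∑ i ∈ S, post n A (g i) x := by
  classical
  induction S using Finset.induction_on with
  | empty => simp [post_zero]
  | insert a S ha ih => rw [Finset.sum_insert ha, Finset.sum_insert ha, post_add, ih]

/-- A map of free modules whose dual is injective on `Ext` does not vanish under maps into `Ext`. -/
lemma ext_hom_injective_eq_zero {k C : Type u} [AddCommGroup k] [Module R k] [AddCommGroup C]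
    [Module R C] (t n n' : ℕ) (f : (Fin n' → R) →ₗ[R] (Fin n → R))
    (hf : Function.Injective (post t k (LinearMap.lcomp R C f)))
    (θ : (Fin n → R) →ₗ[R] E R k C t) (hθ : θ ∘ₗ f = 0) : θ = 0 := by
  let s : ∀ (m : ℕ) (i : Fin m), C →ₗ[R] ((Fin m → R) →ₗ[R] C) := fun m i =>
    LinearMap.smulRightₗ (LinearMap.proj i)
  let v : ∀ (m : ℕ) (j : Fin m), ((Fin m → R) →ₗ[R] C) →ₗ[R] C := fun m j =>
    LinearMap.applyₗ (Pi.single j 1)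
  have hvs : ∀ m (x : E R k ((Fin m → R) →ₗ[R] C) t), (∀ j, post t k (v m j) x = 0) → x = 0 := by
    intro m x hx
    have h1 : ∑ j, s m j ∘ₗ v m j = LinearMap.id := by
      ext φ i
      simp [s, v, Finset.sum_apply, Pi.single_apply]
    rw [← post_id t x, ← h1, post_sum]
    exact Finset.sum_eq_zero fun j _ => by rw [← post_post, hx j, map_zero]
  have h0 : ∑ i, post t k (s n i) (θ (Pi.single i 1)) = 0 := by
    apply hf
    rw [map_zero]
    refine hvs _ _ fun j => ?_
    rw [map_sum, map_sum]
    have h2 : ∀ i, v n' j ∘ₗ LinearMap.lcomp R C f ∘ₗ s n i =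
        (f (Pi.single j 1) i) • LinearMap.id := by
      intro i
      ext c
      simp [s, v]
    calc _ = ∑ i, (f (Pi.single j 1) i) • θ (Pi.single i 1) := by
          refine Finset.sum_congr rfl fun i _ => ?_
          rw [post_post, post_post, LinearMap.comp_assoc, h2, post_smul_id]
      _ = θ (f (Pi.single j 1)) := by
          conv_rhs => rw [← Finset.univ_sum_single (f (Pi.single j 1))]
          rw [map_sum]
          refine Finset.sum_congr rfl fun i _ => ?_
          rw [← map_smul, ← Pi.single_smul, smul_eq_mul, mul_one]
      _ = 0 := LinearMap.congr_fun hθ _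
  refine (Pi.basisFun R (Fin n)).ext fun i => ?_
  have h3 := congrArg (post t k (v n i)) h0
  rw [map_sum, map_zero] at h3
  rw [Finset.sum_eq_single i] at h3
  · rw [post_post, show v n i ∘ₗ s n i = LinearMap.id by ext c; simp [s, v], post_id] at h3
    simpa using h3
  · intro j _ hj
    rw [post_post, show v n i ∘ₗ s n j = 0 by ext c; simp [s, v, hj],
      post_zero]
  · simp

end Semidualizing

end LocalCoh

namespace LocalCoh

open ModExt IsLocalRing

variable {R : Type u} [CommRing R] [IsNoetherianRing R] [IsLocalRing R]

local notation "𝔪" => maximalIdeal R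

omit [IsNoetherianRing R] in
/-- A nonzero finitely generated module and a nonzero vector space over the residue field are
connected by a nonzero map. -/
lemma exists_ne_zero_of_residue (C V : Type u) [AddCommGroup C] [Module R C] [Module.Finite R C]
    [Nontrivial C] [AddCommGroup V] [Module R V] [Nontrivial V] (hV : ∀ r ∈ 𝔪, ∀ x : V, r • x = 0) :
    ∃ c : C →ₗ[R] V, c ≠ 0 := by
  obtain ⟨N, hN⟩ := IsCoatomic.exists_coatom (Submodule R C)
  have : IsSimpleModule R (C ⧸ N) := isSimpleModule_iff_isCoatom.2 hN
  obtain ⟨e⟩ := exists_equiv_of_isSimpleModule (R := R) (A := C ⧸ N)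
  obtain ⟨v, hv⟩ := exists_ne (0 : V)
  let φ : (R ⧸ 𝔪) →ₗ[R] V := Submodule.liftQ 𝔪 (LinearMap.toSpanSingleton R V v)
    (fun r hr => hV r hr v)
  obtain ⟨c, hc⟩ := N.mkQ_surjective (e.symm (Submodule.Quotient.mk 1))
  refine ⟨φ ∘ₗ e.toLinearMap ∘ₗ N.mkQ, fun h => hv ?_⟩
  have h1 := LinearMap.congr_fun h c
  have h2 : φ (e (N.mkQ c)) = 0 := h1
  rw [hc, LinearEquiv.apply_symm_apply] at h2
  rw [← h2]
  exact ((Submodule.liftQ_apply _ _ _).trans (one_smul R v)).symm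

omit [IsNoetherianRing R] in
lemma smul_ext_residue {Y : Type u} [AddCommGroup Y] [Module R Y] (t : ℕ) (r : R) (hr : r ∈ 𝔪)
    (x : E R (R ⧸ 𝔪) Y t) : r • x = 0 := by
  rw [← pre_smul_id, show (r • LinearMap.id : (R ⧸ 𝔪) →ₗ[R] (R ⧸ 𝔪)) = 0 from ?_, pre_zero]
  refine LinearMap.ext fun y => ?_
  obtain ⟨y, rfl⟩ := Submodule.mkQ_surjective _ y
  exact (Submodule.Quotient.mk_eq_zero _).2 (Ideal.mul_mem_right _ _ hr)

/-- A semidualizing module has at least the depth of the ring. -/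
lemma ext_residue_semidualizing (C : Type u) [AddCommGroup C] [Module R C] [Module.Finite R C]
    (hbij : Function.Bijective (LinearMap.lsmul R C)) (hext : ∀ j, Subsingleton (E R C C (j + 1)))
    (d : ℕ) (hR : ∀ i < d, Subsingleton (E R (R ⧸ 𝔪) R i)) :
    ∀ i < d, Subsingleton (E R (R ⧸ 𝔪) C i) := by
  intro t
  induction t using Nat.strong_induction_on with
  | _ t ih =>
  intro ht
  by_contra hV
  rw [not_subsingleton_iff_nontrivial] at hV
  have hC : Nontrivial C := by
    by_contra hC
    rw [not_nontrivial_iff_subsingleton] at hC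
    exact zero_ne_one (hbij.1 (Subsingleton.elim (LinearMap.lsmul R C 0) (LinearMap.lsmul R C 1)))
  obtain ⟨c, hc⟩ := exists_ne_zero_of_residue C (E R (R ⧸ 𝔪) C t)
    (fun r hr x => smul_ext_residue t r hr x)
  obtain ⟨n, g, s⟩ := exists_syzygy (R := R) C
  obtain ⟨n', g', s'⟩ := exists_syzygy (R := R) (LinearMap.ker g)
  have hker : ∀ j, Subsingleton (E R (LinearMap.ker g) C (j + 1)) := fun j => by
    have := hext (j + 1)
    exact (SES_shift s j).subsingleton
  have h1 : Function.Injective (post t (R ⧸ 𝔪) (LinearMap.lcomp R C (LinearMap.ker g).subtype)) := by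
    rw [injective_iff_map_eq_zero]
    intro x hx
    obtain ⟨y, rfl⟩ := ((SES_hom s (hext 0)).post_exact t x).1 hx
    have := hR t ht
    have := (postEquiv t (R ⧸ 𝔪) (LinearEquiv.ofBijective _ hbij)).symm.subsingleton
    rw [Subsingleton.elim y 0, map_zero]
  have h2 : Function.Injective (post t (R ⧸ 𝔪) (LinearMap.lcomp R C g')) := by
    have s'' := SES_hom s' (hker 0)
    cases t with
    | zero => exact post_zero_injective _ s''.inj
    | succ t =>
      have := ext_hom (R ⧸ 𝔪) C t (LinearMap.ker g') (fun j hj => ih j (by omega) (by omega))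
        (fun j => by
          have := hker (j + 1)
          exact (SES_shift s' j).subsingleton)
      rw [injective_iff_map_eq_zero]
      intro x hx
      obtain ⟨y, rfl⟩ := (s''.exact_postδ t x).1 hx
      rw [Subsingleton.elim y 0, map_zero]
  have h3 : c ∘ₗ g = 0 := by
    refine ext_hom_injective_eq_zero t n n' ((LinearMap.ker g).subtype ∘ₗ g') ?_ _ ?_
    · intro x y hxy
      apply h1
      apply h2
      rw [post_post, post_post]
      exact hxy
    · refine LinearMap.ext fun x => ?_
      exact (congrArg c (g' x).2).trans (map_zero c)
  exact hc ((LinearMap.cancel_right s.surj).1 (h3.trans (LinearMap.zero_comp g).symm))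

omit [IsNoetherianRing R] [IsLocalRing R] in
/-- The short exact sequence of multiplication by a regular element. -/
lemma SES_regular {Z : Type u} [AddCommGroup Z] [Module R Z] {x : R} (hx : IsSMulRegular Z x) :
    SES (x • LinearMap.id : Z →ₗ[R] Z) (LinearMap.range (x • LinearMap.id : Z →ₗ[R] Z)).mkQ :=
  SES_of_injective _ hx

/-- Nonzero submodules of modules with large depth have large dimension. -/
lemma le_ringKrullDim_quotient (n : ℕ) : ∀ (Z : Type u) [AddCommGroup Z] [Module R Z]
    [Module.Finite R Z], (∀ i < n, Subsingleton (E R (R ⧸ 𝔪) Z i)) → ∀ (J : Ideal R) (z : Z),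
      z ≠ 0 → (∀ r ∈ J, r • z = 0) → (n : WithBot ℕ∞) ≤ ringKrullDim (R ⧸ J) := by
  induction n with
  | zero =>
    intro Z _ _ _ _ J z hz hJ
    have : Nontrivial (R ⧸ J) := Ideal.Quotient.nontrivial_iff.2 fun h =>
      hz (by rw [← one_smul R z]; exact hJ 1 (h ▸ Submodule.mem_top))
    exact_mod_cast ringKrullDim_nonneg_of_nontrivial
  | succ n ih =>
    intro Z _ _ _ hZ J z hz hJ
    have h0 : Subsingleton ((R ⧸ 𝔪) →ₗ[R] Z) := by
      have := hZ 0 (by omega)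
      exact (homEquiv _ _).symm.subsingleton
    obtain ⟨x, hx, hreg⟩ := IsSMulRegular.subsingleton_linearMap_iff.1 h0
    rw [Ideal.annihilator_quotient] at hx
    let U : Submodule R Z :=
      { carrier := {w | ∀ r ∈ J, r • w = 0}
        zero_mem' := by simp
        add_mem' := fun ha hb r hr => by rw [smul_add, ha r hr, hb r hr, add_zero]
        smul_mem' := fun c a ha r hr => by rw [smul_comm, ha r hr, smul_zero] }
    let J' := Module.annihilator R U
    have hJJ' : J ≤ J' := fun r hr => Module.mem_annihilator.2 fun w => Subtype.ext (w.2 r hr)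
    have hxJ' : Ideal.Quotient.mk J' x ∈ nonZeroDivisors (R ⧸ J') := by
      rw [mem_nonZeroDivisors_iff_right]
      intro r hr
      obtain ⟨r, rfl⟩ := Ideal.Quotient.mk_surjective r
      rw [← map_mul, Ideal.Quotient.eq_zero_iff_mem] at hr
      rw [Ideal.Quotient.eq_zero_iff_mem, Module.mem_annihilator]
      intro w
      apply Subtype.ext
      apply hreg
      have := congrArg Subtype.val (Module.mem_annihilator.1 hr w)
      simpa [mul_comm r x, mul_smul] using this
    obtain ⟨w, hwU, hw⟩ : ∃ w ∈ U, w ∉ LinearMap.range (x • LinearMap.id : Z →ₗ[R] Z) := by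
      by_contra! hcon
      have hU : U ≤ 𝔪 • U := by
        intro w hw
        obtain ⟨v, hv⟩ := hcon w hw
        have hvU : v ∈ U := by
          intro r hr
          apply hreg
          change x • r • v = x • 0
          rw [smul_comm, smul_zero, ← hw r hr, ← hv]
          rfl
        rw [← hv]
        exact Submodule.smul_mem_smul hx hvU
      have := Submodule.eq_bot_of_le_smul_of_le_jacobson_bot 𝔪 U (IsNoetherian.noetherian U) hU
        (IsLocalRing.maximalIdeal_le_jacobson _)
      have hzU : z ∈ U := hJ
      rw [this] at hzU
      exact hz hzU
    have h1 := ih (Z ⧸ LinearMap.range (x • LinearMap.id : Z →ₗ[R] Z)) (fun i hi => by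
      have h1 := hZ i (by omega)
      have h2 := hZ (i + 1) (by omega)
      refine subsingleton_of_forall_eq 0 fun y => ?_
      obtain ⟨y, rfl⟩ := ((SES_regular hreg).postδ_exact i y).1 (Subsingleton.elim _ _)
      rw [Subsingleton.elim y 0, map_zero]) (J' ⊔ Ideal.span {x}) (Submodule.Quotient.mk w)
      (fun h => hw ((Submodule.Quotient.mk_eq_zero _).1 h)) (by
        intro r hr
        obtain ⟨a, ha, b, hb, rfl⟩ := Submodule.mem_sup.1 hr
        obtain ⟨b, rfl⟩ := Ideal.mem_span_singleton'.1 hb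
        rw [← Submodule.Quotient.mk_smul, add_smul]
        refine (Submodule.Quotient.mk_eq_zero _).2 ?_
        rw [show a • w = 0 from congrArg Subtype.val (Module.mem_annihilator.1 ha ⟨w, hwU⟩),
          zero_add]
        exact ⟨b • w, by simp [mul_smul]⟩)
    have h2 : ringKrullDim (R ⧸ (J' ⊔ Ideal.span {x})) ≤
        ringKrullDim ((R ⧸ J') ⧸ Ideal.span {Ideal.Quotient.mk J' x}) := by
      rw [← ringKrullDim_eq_of_ringEquiv (DoubleQuot.quotQuotEquivQuotSup J' (Ideal.span {x})),
        Ideal.map_span, Set.image_singleton]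
    have h3 := ringKrullDim_quotient_succ_le_of_nonZeroDivisor hxJ'
    have h4 : ringKrullDim (R ⧸ J') ≤ ringKrullDim (R ⧸ J) :=
      ringKrullDim_le_of_surjective (Ideal.Quotient.factor hJJ') (Ideal.Quotient.factor_surjective hJJ')
    refine le_trans ?_ (h3.trans h4)
    push_cast
    gcongr
    exact h1.trans h2

end LocalCoh

namespace LocalCoh

open ModExt

variable {R : Type u} [CommRing R]

section Iso

variable {A B D : Type u} [AddCommGroup A] [Module R A] [AddCommGroup B] [Module R B]
  [AddCommGroup D] [Module R D] {f : A →ₗ[R] B} {g : B →ₗ[R] D} (J : Ideal R)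

/-- The connecting map is bijective when the middle term has no cohomology. -/
def HδEquiv (s : SES f g) (i : ℕ) (h : Subsingleton (Paper.LocCoh R J i B))
    (h' : Subsingleton (Paper.LocCoh R J (i + 1) B)) :
    Paper.LocCoh R J i D ≃ₗ[R] Paper.LocCoh R J (i + 1) A :=
  LinearEquiv.ofBijective (Hδ J s i) (by
    constructor
    · rw [injective_iff_map_eq_zero]
      intro x hx
      obtain ⟨y, rfl⟩ := (Hδ_exact J s i x).1 hx
      rw [Subsingleton.elim y 0, map_zero]
    · intro x
      exact (exact_Hδ J s i x).1 (Subsingleton.elim _ _))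

/-- Two terms have the same cohomology if the third has none. -/
def HmapEquiv (s : SES f g) (i : ℕ) (h : Subsingleton (Paper.LocCoh R J i D))
    (h' : Subsingleton (Paper.LocCoh R J (i + 1) D)) :
    Paper.LocCoh R J (i + 1) A ≃ₗ[R] Paper.LocCoh R J (i + 1) B :=
  LinearEquiv.ofBijective (Hmap J (i + 1) f) (by
    constructor
    · rw [injective_iff_map_eq_zero]
      intro x hx
      obtain ⟨y, rfl⟩ := (exact_Hδ J s i x).1 hx
      rw [Subsingleton.elim y 0, map_zero]
    · intro x
      exact (Hmap_exact J s (i + 1) x).1 (Subsingleton.elim _ _))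

end Iso

section Link

variable {K F K' : Type u} [AddCommGroup K] [Module R K] [AddCommGroup F] [Module R F]
  [AddCommGroup K'] [Module R K'] (C : Type u) [AddCommGroup C] [Module R C]
  {ι : K' →ₗ[R] F} {g : F →ₗ[R] K}

lemma SES_hom_range (s : SES ι g) :
    SES (LinearMap.lcomp R C g) (LinearMap.lcomp R C ι).rangeRestrict where
  inj := fun _ _ h => (LinearMap.cancel_right s.surj).1 h
  exact := by
    intro φ
    have h1 : (LinearMap.lcomp R C ι).rangeRestrict φ = 0 ↔ φ ∘ₗ ι = 0 :=
      Subtype.ext_iff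
    rw [h1]
    constructor
    · intro hφ
      have h1 : pre 0 ι C ((homEquiv F C).symm φ) = 0 := by
        apply (homEquiv K' C).injective
        rw [homEquiv_pre, LinearEquiv.apply_symm_apply, map_zero]
        exact hφ
      obtain ⟨y, hy⟩ := (s.pre_exact 0 _).1 h1
      refine ⟨homEquiv K C y, ?_⟩
      have := congrArg (homEquiv F C) hy
      rwa [homEquiv_pre, LinearEquiv.apply_symm_apply] at this
    · rintro ⟨ψ, rfl⟩
      change (ψ ∘ₗ g) ∘ₗ ι = 0
      rw [LinearMap.comp_assoc, s.comp_eq_zero, LinearMap.comp_zero]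
  surj := LinearMap.surjective_rangeRestrict _

/-- The connecting map from homomorphisms on the kernel to the first extension module. -/
def homδ (s : SES ι g) : (K' →ₗ[R] C) →ₗ[R] E R K C 1 :=
  s.preδ C 0 ∘ₗ (homEquiv K' C).symm.toLinearMap

lemma homδ_apply (s : SES ι g) (φ : K' →ₗ[R] C) :
    homδ C s φ = s.preδ C 0 ((homEquiv K' C).symm φ) := rfl

lemma homδ_exact (s : SES ι g) :
    Function.Exact (LinearMap.lcomp R C ι) (homδ C s) := by
  intro φ
  rw [homδ_apply, s.preδ_exact 0]
  constructor
  · rintro ⟨y, hy⟩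
    refine ⟨homEquiv F C y, ?_⟩
    have := congrArg (homEquiv K' C) hy
    rw [homEquiv_pre] at this
    exact this.trans (LinearEquiv.apply_symm_apply _ _)
  · rintro ⟨y, hy⟩
    refine ⟨(homEquiv F C).symm y, ?_⟩
    apply (homEquiv K' C).injective
    rw [homEquiv_pre, LinearEquiv.apply_symm_apply, LinearEquiv.apply_symm_apply]
    exact hy

lemma homδ_surjective (s : SES ι g) [Module.Projective R F] :
    Function.Surjective (homδ C s) := by
  intro x
  have := subsingleton_of_projective (R := R) (A := F) (B := C) 0
  obtain ⟨y, rfl⟩ := (s.exact_preδ 0 x).1 (Subsingleton.elim _ _)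
  exact ⟨homEquiv K' C y, by rw [homδ_apply, LinearEquiv.symm_apply_apply]⟩

lemma SES_homδ (s : SES ι g) [Module.Projective R F] :
    SES (LinearMap.range (LinearMap.lcomp R C ι)).subtype (homδ C s) where
  inj := Subtype.val_injective
  exact := fun φ => (homδ_exact C s φ).trans
    ⟨fun h => ⟨⟨φ, h⟩, rfl⟩, fun ⟨y, hy⟩ => hy ▸ y.2⟩
  surj := homδ_surjective C s

variable (J : Ideal R)

lemma locCoh_range_subsingleton [Module.Finite R K']
    (h0 : Subsingleton (Paper.LocCoh R J 0 C)) :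
    Subsingleton (Paper.LocCoh R J 0 (LinearMap.range (LinearMap.lcomp R C ι))) := by
  obtain ⟨n, g', s'⟩ := exists_syzygy (R := R) K'
  have := locCoh_hom_projective J (Fin n → R) C 0 h0
  have h1 := (Hmap_zero_injective J _ (SES_hom_range C s').inj).subsingleton
  exact (Hmap_zero_injective J (LinearMap.range (LinearMap.lcomp R C ι)).subtype
    Subtype.val_injective).subsingleton

lemma locCoh_hom_zero (h0 : Subsingleton (Paper.LocCoh R J 0 C)) [Module.Finite R K] :
    Subsingleton (Paper.LocCoh R J 0 (K →ₗ[R] C)) := by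
  obtain ⟨n, g', s'⟩ := exists_syzygy (R := R) K
  have := locCoh_hom_projective J (Fin n → R) C 0 h0
  exact (Hmap_zero_injective J _ (SES_hom_range C s').inj).subsingleton

variable [IsNoetherianRing R]

lemma locCoh_hom_one (h0 : Subsingleton (Paper.LocCoh R J 0 C))
    (h1 : Subsingleton (Paper.LocCoh R J 1 C)) [Module.Finite R K] :
    Subsingleton (Paper.LocCoh R J 1 (K →ₗ[R] C)) := by
  obtain ⟨n, g, s⟩ := exists_syzygy (R := R) K
  have h2 := locCoh_hom_projective J (Fin n → R) C 1 h1
  have h3 := locCoh_range_subsingleton C (ι := (LinearMap.ker g).subtype) J h0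
  refine subsingleton_of_forall_eq 0 fun x => ?_
  obtain ⟨y, rfl⟩ := (exact_Hδ J (SES_hom_range C s) 0 x).1 (Subsingleton.elim _ _)
  rw [Subsingleton.elim y 0, map_zero]

/-- If the extension modules `Ext^i(K, C)` are torsion, they are the local cohomology modules
of the image of the dualized inclusion of the first syzygy of `K`. -/
lemma exists_locCoh_range_equiv (d : ℕ) (hH : ∀ i < d, Subsingleton (Paper.LocCoh R J i C))
    (i : ℕ) : ∀ (K F : Type u) [AddCommGroup K] [Module R K] [AddCommGroup F] [Module R F]
      [Module.Finite R F] [Module.Projective R F] (g : F →ₗ[R] K)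
      (_ : SES (LinearMap.ker g).subtype g), (∀ j, Bdd J (E R K C (j + 1))) → i + 1 < d →
        Nonempty (E R K C (i + 1) ≃ₗ[R]
          Paper.LocCoh R J (i + 1) (LinearMap.range (LinearMap.lcomp R C (LinearMap.ker g).subtype))) := by
  induction i with
  | zero =>
    intro K F _ _ _ _ _ _ g s hK hd
    have h0 := hH 0 (by omega)
    have h1 := hH 1 (by omega)
    exact ⟨(evEquiv J (hK 0).gam_eq_top).symm ≪≫ₗ HδEquiv J (SES_homδ C s) 0
      (locCoh_hom_zero C J h0) (locCoh_hom_one C J h0 h1)⟩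
  | succ i ih =>
    intro K F _ _ _ _ _ _ g s hK hd
    obtain ⟨n, g', s'⟩ := exists_syzygy (R := R) (LinearMap.ker g)
    obtain ⟨e⟩ := ih (LinearMap.ker g) (Fin n → R) g' s'
      (fun j => (hK (j + 1)).of_equiv (SES_shift s j).symm) (by omega)
    have hp : ∀ j < d, Subsingleton (Paper.LocCoh R J j ((Fin n → R) →ₗ[R] C)) :=
      fun j hj => locCoh_hom_projective J _ C j (hH j hj)
    exact ⟨(SES_shift s i).symm ≪≫ₗ e ≪≫ₗ
      HδEquiv J (SES_hom_range C s') (i + 1) (hp _ (by omega)) (hp _ (by omega)) ≪≫ₗ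
      (HmapEquiv J (SES_homδ C s) (i + 1)
        (subsingleton_of_torsion J i _ (hK 0).gam_eq_top)
        (subsingleton_of_torsion J (i + 1) _ (hK 0).gam_eq_top)).symm⟩

end Link

end LocalCoh

namespace LocalCoh

open ModExt IsLocalRing

section Sequences

variable {A : Type u} [CommRing A]


lemma ext_subsingleton_middle {Z' Z Z'' C : Type u} [AddCommGroup Z'] [Module A Z'] [AddCommGroup Z]
    [Module A Z] [AddCommGroup Z''] [Module A Z''] [AddCommGroup C] [Module A C]
    {f : Z' →ₗ[A] Z} {g : Z →ₗ[A] Z''} (s : SES f g) (i : ℕ) (h1 : Subsingleton (E A Z' C i))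
    (h2 : Subsingleton (E A Z'' C i)) : Subsingleton (E A Z C i) := by
  refine subsingleton_of_forall_eq 0 fun x => ?_
  obtain ⟨y, rfl⟩ := (s.pre_exact i x).1 (Subsingleton.elim _ _)
  rw [Subsingleton.elim y 0, map_zero]

lemma ext_subsingleton_left {Z' Z Z'' C : Type u} [AddCommGroup Z'] [Module A Z']
    [AddCommGroup Z] [Module A Z] [AddCommGroup Z''] [Module A Z''] [AddCommGroup C] [Module A C]
    {f : Z' →ₗ[A] Z} {g : Z →ₗ[A] Z''} (s : SES f g) (i : ℕ) (h1 : Subsingleton (E A Z C i))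
    (h2 : Subsingleton (E A Z'' C (i + 1))) : Subsingleton (E A Z' C i) := by
  refine subsingleton_of_forall_eq 0 fun x => ?_
  obtain ⟨y, rfl⟩ := (s.preδ_exact i x).1 (Subsingleton.elim _ _)
  rw [Subsingleton.elim y 0, map_zero]

lemma ext_subsingleton_right {Z' Z Z'' C : Type u} [AddCommGroup Z'] [Module A Z']
    [AddCommGroup Z] [Module A Z] [AddCommGroup Z''] [Module A Z''] [AddCommGroup C] [Module A C]
    {f : Z' →ₗ[A] Z} {g : Z →ₗ[A] Z''} (s : SES f g) (i : ℕ) (h1 : Subsingleton (E A Z' C i))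
    (h2 : Subsingleton (E A Z C (i + 1))) : Subsingleton (E A Z'' C (i + 1)) := by
  refine subsingleton_of_forall_eq 0 fun x => ?_
  obtain ⟨y, rfl⟩ := (s.exact_preδ i x).1 (Subsingleton.elim _ _)
  rw [Subsingleton.elim y 0, map_zero]

/-- Multiplication by a regular element lowers the dimension. -/
lemma ringKrullDim_quotient_annihilator_succ_le (Z : Type u) [AddCommGroup Z] [Module A Z] {x : A}
    (hx : IsSMulRegular Z x) :
    ringKrullDim (A ⧸ Module.annihilator A (Z ⧸ LinearMap.range (x • LinearMap.id : Z →ₗ[A] Z))) + 1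
      ≤ ringKrullDim (A ⧸ Module.annihilator A Z) := by
  set I := Module.annihilator A Z
  have hreg : Ideal.Quotient.mk I x ∈ nonZeroDivisors (A ⧸ I) := by
    rw [mem_nonZeroDivisors_iff_right]
    intro r hr
    obtain ⟨r, rfl⟩ := Ideal.Quotient.mk_surjective r
    rw [← map_mul, Ideal.Quotient.eq_zero_iff_mem] at hr
    rw [Ideal.Quotient.eq_zero_iff_mem, Module.mem_annihilator]
    intro w
    apply hx
    have := Module.mem_annihilator.1 hr w
    simpa [mul_comm r x, mul_smul] using this
  have h2 : ringKrullDim (A ⧸ (I ⊔ Ideal.span {x})) =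
      ringKrullDim ((A ⧸ I) ⧸ Ideal.span {Ideal.Quotient.mk I x}) := by
    rw [← ringKrullDim_eq_of_ringEquiv (DoubleQuot.quotQuotEquivQuotSup I (Ideal.span {x})),
      Ideal.map_span, Set.image_singleton]
  have h3 := ringKrullDim_quotient_succ_le_of_nonZeroDivisor hreg
  have h4 : I ⊔ Ideal.span {x} ≤
      Module.annihilator A (Z ⧸ LinearMap.range (x • LinearMap.id : Z →ₗ[A] Z)) := by
    intro r hr
    obtain ⟨a, ha, b, hb, rfl⟩ := Submodule.mem_sup.1 hr
    obtain ⟨b, rfl⟩ := Ideal.mem_span_singleton'.1 hb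
    rw [Module.mem_annihilator]
    intro w
    obtain ⟨w, rfl⟩ := Submodule.mkQ_surjective _ w
    rw [← map_smul, add_smul, Module.mem_annihilator.1 ha, zero_add]
    exact (Submodule.Quotient.mk_eq_zero _).2 ⟨b • w, by simp [mul_smul]⟩
  refine le_trans ?_ h3
  rw [← h2]
  gcongr
  exact ringKrullDim_le_of_surjective (Ideal.Quotient.factor h4) (Ideal.Quotient.factor_surjective h4)

end Sequences

section InjDim

variable {A : Type u} [CommRing A] [IsNoetherianRing A] [IsLocalRing A]

local notation "𝔪" => maximalIdeal A

lemma exists_residue_embedding_of_not_regular {Z : Type u} [AddCommGroup Z] [Module A Z]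
    (hZ : ¬ ∃ x ∈ 𝔪, IsSMulRegular Z x) [Module.Finite A Z] :
    ∃ f : (A ⧸ 𝔪) →ₗ[A] Z, Function.Injective f := by
  have h1 : ¬ Subsingleton ((A ⧸ 𝔪) →ₗ[A] Z) := by
    intro h
    obtain ⟨x, hx, hx'⟩ := IsSMulRegular.subsingleton_linearMap_iff.1 h
    rw [Ideal.annihilator_quotient] at hx
    exact hZ ⟨x, hx, hx'⟩
  rw [not_subsingleton_iff_nontrivial] at h1
  obtain ⟨f, hf⟩ := exists_ne (0 : (A ⧸ 𝔪) →ₗ[A] Z)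
  have : IsSimpleModule A (A ⧸ 𝔪) := isSimpleModule_iff_isCoatom.2 (maximalIdeal.isMaximal A).out
  exact ⟨f, f.injective_or_eq_zero.resolve_right hf⟩

omit [IsNoetherianRing A] in
lemma nontrivial_quotient_range_smul {Z : Type u} [AddCommGroup Z] [Module A Z] [Module.Finite A Z]
    [Nontrivial Z] {x : A} (hx : x ∈ 𝔪) :
    Nontrivial (Z ⧸ LinearMap.range (x • LinearMap.id : Z →ₗ[A] Z)) := by
  rw [Submodule.Quotient.nontrivial_iff]
  intro h
  have h1 : (⊤ : Submodule A Z) ≤ 𝔪 • ⊤ := by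
    rw [← h]
    rintro _ ⟨z, rfl⟩
    exact Submodule.smul_mem_smul hx (h ▸ Submodule.mem_top)
  exact bot_ne_top (Submodule.eq_bot_of_le_smul_of_le_jacobson_bot 𝔪 (⊤ : Submodule A Z)
    Module.Finite.fg_top h1 (IsLocalRing.maximalIdeal_le_jacobson _)).symm

/-- The residue field embeds into a module over which `Ext` vanishes beyond the dimension. -/
lemma exists_residue_embedding (C : Type u) [AddCommGroup C] [Module A C] (j : ℕ) :
    ∀ (a : ℕ) (Z : Type u) [AddCommGroup Z] [Module A Z] [Module.Finite A Z] [Nontrivial Z],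
      (∀ i, a < i → Subsingleton (E A Z C i)) →
      ringKrullDim (A ⧸ Module.annihilator A Z) ≤ j →
      ∃ (Y : Type u) (_ : AddCommGroup Y) (_ : Module A Y) (f : (A ⧸ 𝔪) →ₗ[A] Y),
        Module.Finite A Y ∧ Function.Injective f ∧ ∀ i, a + j < i → Subsingleton (E A Y C i) := by
  induction j with
  | zero =>
    intro a Z _ _ _ _ hZ hdim
    have h : ¬ ∃ x ∈ 𝔪, IsSMulRegular Z x := by
      rintro ⟨x, hx, hreg⟩
      have h1 := (ringKrullDim_quotient_annihilator_succ_le Z hreg).trans hdim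
      have := nontrivial_quotient_range_smul (Z := Z) hx
      have h2 : Nontrivial (A ⧸ Module.annihilator A
          (Z ⧸ LinearMap.range (x • LinearMap.id : Z →ₗ[A] Z))) :=
        Ideal.Quotient.nontrivial_iff.2 fun h => not_subsingleton _ (Module.annihilator_eq_top_iff.1 h)
      have h3 := (add_le_add_left (ringKrullDim_nonneg_of_nontrivial (R := A ⧸ Module.annihilator A
          (Z ⧸ LinearMap.range (x • LinearMap.id : Z →ₗ[A] Z)))) 1).trans h1
      norm_num at h3
    obtain ⟨f, hf⟩ := exists_residue_embedding_of_not_regular h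
    exact ⟨Z, _, _, f, inferInstance, hf, fun i hi => hZ i (by omega)⟩
  | succ j ih =>
    intro a Z _ _ _ _ hZ hdim
    by_cases h : ∃ x ∈ 𝔪, IsSMulRegular Z x
    · obtain ⟨x, hx, hreg⟩ := h
      have h1 := (ringKrullDim_quotient_annihilator_succ_le Z hreg).trans hdim
      have := nontrivial_quotient_range_smul (Z := Z) hx
      obtain ⟨Y, iY, mY, f, hfin, hf, hY⟩ := ih (a + 1)
        (Z ⧸ LinearMap.range (x • LinearMap.id : Z →ₗ[A] Z)) (fun i hi => by
          obtain ⟨i, rfl⟩ := Nat.exists_eq_succ_of_ne_zero (by omega : i ≠ 0)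
          exact ext_subsingleton_right (SES_regular hreg) i (hZ i (by omega)) (hZ _ (by omega)))
        (by
          push_cast at h1
          exact ENat.WithBot.add_le_add_one_right_iff.1 h1)
      exact ⟨Y, iY, mY, f, hfin, hf, fun i hi => hY i (by omega)⟩
    · obtain ⟨f, hf⟩ := exists_residue_embedding_of_not_regular h
      exact ⟨Z, _, _, f, inferInstance, hf, fun i hi => hZ i (by omega)⟩

/-- Finite injective dimension forces `Ext` to vanish beyond the dimension of the ring. -/
lemma ext_subsingleton_of_finite_injDim (C : Type u) [AddCommGroup C] [Module A C]
    [Module.Finite A C] (hC : Paper.HasFiniteInjDim A C) (h : ℕ) (hdim : ringKrullDim A ≤ h)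
    (i : ℕ) (hi : h < i) (Z : Type u) [AddCommGroup Z] [Module A Z] [Module.Finite A Z] :
    Subsingleton (E A Z C i) := by
  obtain ⟨N, hN⟩ := hC
  obtain ⟨Y, _, _, f, hfin, hf, hY⟩ := exists_residue_embedding C h 0 A
    (fun i hi => by
      obtain ⟨i, rfl⟩ := Nat.exists_eq_succ_of_ne_zero (by omega : i ≠ 0)
      exact subsingleton_of_projective i) ((ringKrullDim_quotient_le _).trans hdim)
  suffices key : ∀ (m i : ℕ), h < i → N < i + m → ∀ (Z : Type u) [AddCommGroup Z] [Module A Z]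
      [Module.Finite A Z], Subsingleton (E A Z C i) from key (N + 1) i hi (by omega) Z
  intro m
  induction m with
  | zero =>
    intro i _ hi Z _ _ _
    have := hN (ModuleCat.of A Z) i hi
    exact (ExtComparison.extEquiv i (ModuleCat.of A Z) (ModuleCat.of A C)).symm.subsingleton
  | succ m ih =>
    intro i hi hi' Z _ _ _
    have hk : Subsingleton (E A (A ⧸ 𝔪) C i) :=
      ext_subsingleton_left (SES_of_injective f hf) i (hY i (by omega))
        (ih (i + 1) (by omega) (by omega) _)
    have hΓ : Subsingleton (E A (gam 𝔪 Z) C i) :=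
      ext_subsingleton_of_isFiniteLength i hk (Bdd.gam (J := 𝔪) (A := Z)).isFiniteLength
    refine ext_subsingleton_middle (SES_submodule (gam 𝔪 Z)) i hΓ ?_
    obtain ⟨x, hx, hreg⟩ := exists_regular (gam_quotient_gam (J := 𝔪) (A := Z))
    have h1 := ih (i + 1) (by omega) (by omega)
      ((Z ⧸ gam 𝔪 Z) ⧸ LinearMap.range (x • LinearMap.id : (Z ⧸ gam 𝔪 Z) →ₗ[A] (Z ⧸ gam 𝔪 Z)))
    have h2 : (⊤ : Submodule A (E A (Z ⧸ gam 𝔪 Z) C i)) ≤ 𝔪 • ⊤ := by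
      intro w _
      obtain ⟨y, rfl⟩ := ((SES_regular hreg).preδ_exact i w).1 (Subsingleton.elim _ _)
      rw [pre_smul_id]
      exact Submodule.smul_mem_smul hx Submodule.mem_top
    have h3 := Submodule.eq_bot_of_le_smul_of_le_jacobson_bot 𝔪 _ Module.Finite.fg_top h2
      (IsLocalRing.maximalIdeal_le_jacobson _)
    exact (Submodule.subsingleton_iff A).1 (subsingleton_of_bot_eq_top h3.symm)

end InjDim

section Localization

variable {R : Type u} [CommRing R] [IsNoetherianRing R] (S : Submonoid R)

local notation "A" => Localization S

omit [IsNoetherianRing R] in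
lemma SES_localized {Z' Z Z'' : Type u} [AddCommGroup Z'] [Module R Z'] [AddCommGroup Z]
    [Module R Z] [AddCommGroup Z''] [Module R Z''] {f : Z' →ₗ[R] Z} {g : Z →ₗ[R] Z''} (s : SES f g) :
    SES (LocalizedModule.map S f) (LocalizedModule.map S g) where
  inj := LocalizedModule.map_injective S f s.inj
  exact := LocalizedModule.map_exact S f g s.exact
  surj := LocalizedModule.map_surjective S g s.surj

/-- If the localized `Ext` vanishes then every class is killed by an element of `S`. -/
lemma exists_smul_ext_eq_zero (C : Type u) [AddCommGroup C] [Module R C] (i : ℕ) :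
    ∀ (Z : Type u) [AddCommGroup Z] [Module R Z] [Module.Finite R Z],
      Subsingleton (E A (LocalizedModule S Z) (LocalizedModule S C) (i + 1)) →
      ∀ x : E R Z C (i + 1), ∃ t ∈ S, t • x = 0 := by
  induction i with
  | zero =>
    intro Z _ _ _ hZ x
    obtain ⟨n, g, s⟩ := exists_syzygy (R := R) Z
    obtain ⟨φ, rfl⟩ := homδ_surjective C s x
    set ι := (LinearMap.ker g).subtype
    have sl := SES_localized S s
    obtain ⟨ψ, hψ⟩ := (homδ_exact _ sl (LocalizedModule.map S φ)).1 (Subsingleton.elim _ _)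
    obtain ⟨ψ₀, t, ht⟩ := Module.FinitePresentation.exists_lift_of_isLocalizedModule S
      (LocalizedModule.mkLinearMap S C)
      ((ψ.restrictScalars R) ∘ₗ (LocalizedModule.mkLinearMap S (Fin n → R)))
    obtain ⟨t', ht'⟩ := Module.Finite.exists_smul_of_comp_eq_of_isLocalizedModule S
      (LocalizedModule.mkLinearMap S C) (ψ₀ ∘ₗ ι) ((t : R) • φ) (by
        refine LinearMap.ext fun y => ?_
        have h1 := LinearMap.congr_fun ht (ι y)
        have h2 := LinearMap.congr_fun hψ (LocalizedModule.mkLinearMap S _ y)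
        have h3 : ψ (LocalizedModule.mkLinearMap S _ (ι y)) =
            LocalizedModule.mkLinearMap S _ (φ y) := by
          simpa using h2
        refine h1.trans ((congrArg ((t : R) • ·) h3).trans ?_)
        exact (map_smul (LocalizedModule.mkLinearMap S C) (t : R) (φ y)).symm)
    refine ⟨t' * t, mul_mem t'.2 t.2, ?_⟩
    rw [← map_smul, mul_smul]
    refine (homδ_exact C s _).2 ⟨(t' : R) • ψ₀, ?_⟩
    exact ht'
  | succ i ih =>
    intro Z _ _ _ hZ x
    obtain ⟨n, g, s⟩ := exists_syzygy (R := R) Z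
    have sl := SES_localized S s
    obtain ⟨t, ht, h⟩ := ih (LinearMap.ker g) (SES_shift sl i).subsingleton ((SES_shift s i).symm x)
    refine ⟨t, ht, ?_⟩
    rw [← map_smul] at h
    exact (LinearEquiv.map_eq_zero_iff _).1 h

end Localization

end LocalCoh

namespace LocalCoh

open ModExt IsLocalRing

section Support

variable {R : Type u} [CommRing R]

/-- A form of Nakayama's lemma at a prime of the support. -/
lemma exists_pow_mem_sup_span {W : Type u} [AddCommGroup W] [Module R W] [Module.Finite R W]
    (q : Ideal R) (hq : Module.annihilator R W ≤ q) (r x : R) (h : ∀ w : W, ∃ w', r • w = x • w') :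
    ∃ n, r ^ n ∈ q ⊔ Ideal.span {x} := by
  obtain ⟨p, hp, -, hc, h0⟩ :=
    LinearMap.exists_monic_and_natDegree_eq_and_coeff_mem_pow_and_aeval_eq_zero R
      (algebraMap R (Module.End R W) r) (Ideal.span {x}) (by
        rintro _ ⟨w, rfl⟩
        obtain ⟨w', hw⟩ := h w
        rw [Module.algebraMap_end_apply, hw]
        exact Submodule.smul_mem_smul (Ideal.mem_span_singleton_self x) Submodule.mem_top)
  refine ⟨p.natDegree, ?_⟩
  have h1 : p.eval r ∈ q := by
    refine hq (Module.mem_annihilator.2 fun w => ?_)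
    rw [Polynomial.aeval_algebraMap_apply] at h0
    exact LinearMap.congr_fun h0 w
  rw [Polynomial.eval_eq_sum_range, Finset.sum_range_succ, hp.coeff_natDegree, one_mul] at h1
  have h2 : ∑ k ∈ Finset.range p.natDegree, p.coeff k * r ^ k ∈ Ideal.span {x} :=
    Ideal.sum_mem _ fun k hk => Ideal.mul_mem_right _ _
      (Ideal.pow_le_self (by have := Finset.mem_range.1 hk; omega) (hc k))
  have h3 := Ideal.sub_mem (q ⊔ Ideal.span {x}) (Ideal.mem_sup_left h1) (Ideal.mem_sup_right h2)
  rwa [add_sub_cancel_left] at h3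

variable [IsNoetherianRing R] [IsLocalRing R]

local notation "𝔪" => maximalIdeal R

/-- A finitely generated module supported at the maximal ideal is torsion. -/
lemma bdd_of_support {W : Type u} [AddCommGroup W] [Module R W]
    (h : ∀ q : Ideal R, q.IsPrime → Module.annihilator R W ≤ q → q = 𝔪) : Bdd 𝔪 W := by
  have h1 : 𝔪 ≤ (Module.annihilator R W).radical := by
    rw [Ideal.radical_eq_sInf]
    exact le_sInf fun q hq => (h q hq.2 hq.1).ge
  obtain ⟨k, hk⟩ := Ideal.exists_pow_le_of_le_radical_of_fg h1 (IsNoetherian.noetherian _)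
  exact ⟨k, fun r hr x => Module.mem_annihilator.1 (hk hr) x⟩

omit [IsNoetherianRing R] in
lemma eq_of_maximalIdeal_pow_le {q : Ideal R} (hq : q.IsPrime) {l : ℕ} (h : 𝔪 ^ l ≤ q) : q = 𝔪 :=
  ((maximalIdeal.isMaximal R).eq_of_le hq.ne_top (hq.le_of_pow_le h)).symm

/-- If `q = ann z` for a nonzero `z`, a regular element `x` with `𝔪 ^ l ≤ q + (x)` makes the
first local cohomology unbounded. -/
lemma not_maximalIdeal_pow_le {Z : Type u} [AddCommGroup Z] [Module R Z] [Module.Finite R Z]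
    (hΓ : gam 𝔪 Z = ⊥) (hH : Bdd 𝔪 (Paper.LocCoh R 𝔪 1 Z)) (q : Ideal R) (z : Z) (hz : z ≠ 0)
    (hqz : ∀ r ∈ q, r • z = 0) (x : R) (hx : x ∈ 𝔪) (hreg : IsSMulRegular Z x) (l : ℕ) :
    ¬ 𝔪 ^ l ≤ q ⊔ Ideal.span {x} := by
  intro hle
  let U : Submodule R Z :=
    { carrier := {w | ∀ r ∈ q, r • w = 0}
      zero_mem' := by simp
      add_mem' := fun ha hb r hr => by rw [smul_add, ha r hr, hb r hr, add_zero]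
      smul_mem' := fun c a ha r hr => by rw [smul_comm, ha r hr, smul_zero] }
  obtain ⟨k, hk⟩ := hH
  have hregk : IsSMulRegular Z (x ^ (k + 1)) := hreg.pow _
  have s := SES_regular hregk
  have h0 := H0_subsingleton 𝔪 hΓ
  have hkill : ∀ w ∈ gam 𝔪 (Z ⧸ LinearMap.range (x ^ (k + 1) • LinearMap.id : Z →ₗ[R] Z)),
      x ^ k • w = 0 := by
    intro w hw
    obtain ⟨y, rfl⟩ := exists_ev 𝔪 hw
    rw [← map_smul]
    have h1 : Hδ 𝔪 s 0 (x ^ k • y) = 0 := by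
      rw [map_smul]
      exact hk _ (Ideal.pow_mem_pow hx k) _
    obtain ⟨v, hv⟩ := (Hδ_exact 𝔪 s 0 _).1 h1
    rw [← hv, Subsingleton.elim v 0, map_zero, map_zero]
  have hU : U ≤ 𝔪 • U := by
    intro u hu
    have h1 := hkill (Submodule.mkQ _ u) ⟨l * (1 + (k + 1)), fun r hr => by
      have h2 : r ∈ q ⊔ Ideal.span {x} ^ (k + 1) := by
        have := Ideal.pow_right_mono hle (1 + (k + 1)) (pow_mul (𝔪) l _ ▸ hr)
        simpa using Ideal.sup_pow_add_le_pow_sup_pow this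
      rw [Ideal.span_singleton_pow] at h2
      obtain ⟨a, ha, b, hb, rfl⟩ := Submodule.mem_sup.1 h2
      obtain ⟨b, rfl⟩ := Ideal.mem_span_singleton'.1 hb
      rw [← map_smul, add_smul, hu a ha, zero_add]
      exact (Submodule.Quotient.mk_eq_zero _).2 ⟨b • u, by simp [mul_smul, smul_comm b]⟩⟩
    rw [← map_smul] at h1
    obtain ⟨v, hv⟩ := (Submodule.Quotient.mk_eq_zero _).1 h1
    have hv' : x • v = u := by
      apply hreg.pow k
      change x ^ k • x • v = x ^ k • u
      rw [← mul_smul, ← pow_succ]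
      exact hv
    have hvU : v ∈ U := by
      intro r hr
      apply hreg
      change x • r • v = x • 0
      rw [smul_comm, smul_zero, hv']
      exact hu r hr
    rw [← hv']
    exact Submodule.smul_mem_smul hx hvU
  have hbot := Submodule.eq_bot_of_le_smul_of_le_jacobson_bot 𝔪 U (IsNoetherian.noetherian U) hU
    (IsLocalRing.maximalIdeal_le_jacobson _)
  have hzU : z ∈ U := hqz
  rw [hbot] at hzU
  exact hz hzU

omit [IsLocalRing R] in
lemma exists_isAssociatedPrime_of_not_regular {Z : Type u} [AddCommGroup Z] [Module R Z]
    [Module.Finite R Z] (q : Ideal R) (hq : ∀ y ∈ q, ¬ IsSMulRegular Z y) :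
    ∃ q' : Ideal R, q'.IsPrime ∧ q ≤ q' ∧ ∃ z : Z, z ≠ 0 ∧ ∀ r, r ∈ q' ↔ r • z = 0 := by
  have h1 : ¬ Subsingleton ((R ⧸ q) →ₗ[R] Z) := by
    intro h
    obtain ⟨x, hx, hx'⟩ := IsSMulRegular.subsingleton_linearMap_iff.1 h
    rw [Ideal.annihilator_quotient] at hx
    exact hq x hx hx'
  rw [not_subsingleton_iff_nontrivial] at h1
  obtain ⟨f, hf⟩ := exists_ne (0 : (R ⧸ q) →ₗ[R] Z)
  have hv : f (Submodule.Quotient.mk 1) ≠ 0 := by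
    intro h
    refine hf (LinearMap.ext fun y => ?_)
    obtain ⟨y, rfl⟩ := Submodule.mkQ_surjective _ y
    have : (Submodule.mkQ q) y = y • Submodule.Quotient.mk 1 := by
      rw [← Submodule.Quotient.mk_smul, smul_eq_mul, mul_one]
      rfl
    rw [this, map_smul, h, smul_zero]
    rfl
  obtain ⟨q', hq', hle⟩ := exists_le_isAssociatedPrime_of_isNoetherianRing R _ hv
  obtain ⟨hp, z, hz⟩ := isAssociatedPrime_iff.1 hq'
  have hmem : ∀ r, r ∈ q' ↔ r • z = 0 := fun r => by
    rw [hz, Submodule.mem_colon_singleton, Submodule.mem_bot]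
  refine ⟨q', hp, fun r hr => hle ?_, z, ?_, hmem⟩
  · rw [Submodule.mem_colon_singleton, Submodule.mem_bot, ← map_smul, ← Submodule.Quotient.mk_smul,
      (Submodule.Quotient.mk_eq_zero q).2 (show r • (1 : R) ∈ q from Ideal.mul_mem_right _ _ hr)]
    exact map_zero f
  · rintro rfl
    exact hp.ne_top ((Ideal.eq_top_iff_one _).2 ((hmem 1).2 (smul_zero _)))

/-- Modules with bounded lower local cohomology have torsion higher `Ext` into a module which is
dualizing on the punctured spectrum. -/
lemma bdd_ext_of_bdd_locCoh (C : Type u) [AddCommGroup C] [Module R C] [Module.Finite R C] (d : ℕ)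
    (hV : ∀ q : Ideal R, q.IsPrime → q ≠ 𝔪 → ∀ (Z : Type u) [AddCommGroup Z] [Module R Z]
      [Module.Finite R Z] (i : ℕ), d ≤ i + 1 → ∀ w : E R Z C (i + 1), ∃ t ∉ q, t • w = 0) (n : ℕ) :
    ∀ (Z : Type u) [AddCommGroup Z] [Module R Z] [Module.Finite R Z],
      (∀ j < n, Bdd 𝔪 (Paper.LocCoh R 𝔪 j Z)) → ∀ i, d < i + 1 + n → Bdd 𝔪 (E R Z C (i + 1)) := by
  have hsupp : ∀ q : Ideal R, q.IsPrime → q ≠ 𝔪 → ∀ (Z : Type u) [AddCommGroup Z] [Module R Z]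
      [Module.Finite R Z] (i : ℕ), d ≤ i + 1 → ¬ Module.annihilator R (E R Z C (i + 1)) ≤ q := by
    intro q hq hne Z _ _ _ i hi hle
    have h1 := (Module.mem_support_iff_of_finite (M := E R Z C (i + 1)) (p := ⟨q, hq⟩)).2 hle
    exact Module.notMem_support_iff'.2 (hV q hq hne Z i hi) h1
  induction n with
  | zero =>
    intro Z _ _ _ _ i hi
    refine bdd_of_support fun q hq hle => ?_
    by_contra hne
    exact hsupp q hq hne Z i (by omega) hle
  | succ n ih =>
    suffices key : ∀ (Z : Type u) [AddCommGroup Z] [Module R Z] [Module.Finite R Z],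
        gam 𝔪 Z = ⊥ → (∀ j < n + 1, Bdd 𝔪 (Paper.LocCoh R 𝔪 j Z)) → ∀ i, d < i + 1 + (n + 1) →
          Bdd 𝔪 (E R Z C (i + 1)) by
      intro Z _ _ _ hZ i hi
      have s := SES_submodule (gam 𝔪 Z)
      refine .of_exact (s.pre_exact (i + 1)) (key (Z ⧸ gam 𝔪 Z) gam_quotient_gam (fun j hj => ?_) i hi)
        ((Bdd.gam (J := 𝔪) (A := Z)).ext_left (i + 1))
      have := subsingleton_of_torsion 𝔪 j (gam 𝔪 Z) (Bdd.gam (J := 𝔪) (A := Z)).gam_eq_top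
      exact .of_exact (Hδ_exact 𝔪 s j) (hZ j hj) .of_subsingleton
    intro Z _ _ _ hΓ hZ i hi
    refine bdd_of_support fun q hq hle => ?_
    by_contra hne
    have hreg : ∀ y ∈ 𝔪, IsSMulRegular Z y → ∃ l, ∀ r ∈ 𝔪 ^ l, ∀ w : E R Z C (i + 1),
        ∃ w', r • w = y • w' := by
      intro y hy hyr
      have s := SES_regular hyr
      obtain ⟨l, hl⟩ := ih (Z ⧸ LinearMap.range (y • LinearMap.id : Z →ₗ[R] Z)) (fun j hj =>
        .of_exact (Hδ_exact 𝔪 s j) (hZ j (by omega)) (hZ (j + 1) (by omega))) (i + 1) (by omega)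
      refine ⟨l, fun r hr w => ?_⟩
      have h1 : s.preδ C (i + 1) (r • w) = 0 := by rw [map_smul, hl r hr]
      obtain ⟨w', hw'⟩ := (s.preδ_exact (i + 1) _).1 h1
      exact ⟨w', by rw [← hw', pre_smul_id]⟩
    by_cases hqr : ∃ y ∈ q, IsSMulRegular Z y
    · obtain ⟨y, hy, hyr⟩ := hqr
      obtain ⟨l, hl⟩ := hreg y (le_maximalIdeal hq.ne_top hy) hyr
      refine hne (eq_of_maximalIdeal_pow_le (l := l) hq fun r hr => ?_)
      obtain ⟨k, hk⟩ := exists_pow_mem_sup_span q hle r y (hl r hr)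
      rw [sup_eq_left.2 ((Ideal.span_singleton_le_iff_mem q).2 hy)] at hk
      exact hq.mem_of_pow_mem _ hk
    · push Not at hqr
      obtain ⟨q', hq', hqq', z, hz, hann⟩ := exists_isAssociatedPrime_of_not_regular q hqr
      have hne' : q' ≠ 𝔪 := by
        rintro rfl
        have : z ∈ gam 𝔪 Z := ⟨1, fun r hr => (hann r).1 (pow_one (𝔪) ▸ hr)⟩
        rw [hΓ] at this
        exact hz this
      by_cases hid : d ≤ i + 1
      · exact hsupp q' hq' hne' Z i hid (hle.trans hqq')
      obtain ⟨x, hx, hxr⟩ := exists_regular hΓ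
      obtain ⟨l, hl⟩ := hreg x hx hxr
      have h1 : 𝔪 ≤ (q' ⊔ Ideal.span {x}).radical := by
        have h2 : 𝔪 ^ l ≤ (q' ⊔ Ideal.span {x}).radical := fun r hr =>
          exists_pow_mem_sup_span q' (hle.trans hqq') r x (hl r hr)
        intro r hr
        obtain ⟨k, hk⟩ := h2 (Ideal.pow_mem_pow hr l)
        exact ⟨l * k, by rwa [pow_mul]⟩
      obtain ⟨l', hl'⟩ := Ideal.exists_pow_le_of_le_radical_of_fg h1 (IsNoetherian.noetherian _)
      exact not_maximalIdeal_pow_le hΓ (hZ 1 (by omega)) q' z hz (fun r hr => (hann r).1 hr) x hx hxr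
        l' hl'

end Support

end LocalCoh

namespace LocalCoh

open ModExt IsLocalRing

section Main

variable {R : Type u} [CommRing R]

/-- The comparison between the two versions of `Ext`. -/
def extGrpEquiv (A B : Type u) [AddCommGroup A] [Module R A] [AddCommGroup B] [Module R B]
    (i : ℕ) : Paper.ExtGrp R A B i ≃ₗ[R] E R A B i :=
  ExtComparison.extEquiv i (ModuleCat.of R A) (ModuleCat.of R B)

section Presentation

variable (C : Type u) [AddCommGroup C] [Module R C] {X : Type u} [AddCommGroup X] [Module R X]
  (pres : Paper.MinPres R X)

/-- The range of `Hom(f, C)` only depends on the image of `f`. -/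
def rangeHomCEquiv : LinearMap.range (LinearMap.lcomp R C (LinearMap.ker pres.g).subtype) ≃ₗ[R]
    LinearMap.range (pres.homC C) := by
  let p : pres.P₁ →ₗ[R] LinearMap.ker pres.g :=
    pres.f.codRestrict _ fun x => pres.exact ▸ LinearMap.mem_range_self _ x
  have hp : Function.Surjective p := by
    rintro ⟨y, hy⟩
    rw [← pres.exact] at hy
    obtain ⟨x, hx⟩ := hy
    exact ⟨x, Subtype.ext hx⟩
  have hinj : Function.Injective (LinearMap.lcomp R C p) := fun a b h =>
    LinearMap.ext fun y => by
      obtain ⟨x, rfl⟩ := hp y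
      exact LinearMap.congr_fun h x
  have hcomp : pres.homC C =
      LinearMap.lcomp R C p ∘ₗ LinearMap.lcomp R C (LinearMap.ker pres.g).subtype := rfl
  exact (Submodule.equivMapOfInjective _ hinj _).trans
    (LinearEquiv.ofEq _ _ (by rw [hcomp, LinearMap.range_comp]))

lemma range_homC_eq_bot_of_f_eq_zero (h : pres.f = 0) : LinearMap.range (pres.homC C) = ⊥ := by
  rw [LinearMap.range_eq_bot]
  refine LinearMap.ext fun a => LinearMap.ext fun x => ?_
  change a (pres.f x) = 0
  rw [h, LinearMap.zero_apply, map_zero]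

lemma f_eq_zero_of_subsingleton [Subsingleton X] : pres.f = 0 := by
  have h : LinearMap.ker pres.g = ⊤ := Submodule.eq_top_iff'.2 fun x => Subsingleton.elim _ _
  have h' := pres.min₀ ⊥ (by rw [h, bot_sup_eq])
  exact LinearMap.ext fun x => (Submodule.mem_bot R).1 (h' ▸ Submodule.mem_top)

/-- A minimal presentation of a projective module has zero differential. -/
lemma f_eq_zero_of_projective [Module.Projective R X] : pres.f = 0 := by
  obtain ⟨s, hs⟩ := Module.projective_lifting_property pres.g LinearMap.id pres.surj
  have h : LinearMap.range s = ⊤ := by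
    refine pres.min₀ _ (Submodule.eq_top_iff'.2 fun x => ?_)
    refine Submodule.mem_sup.2 ⟨s (pres.g x), ⟨_, rfl⟩, x - s (pres.g x), ?_, add_sub_cancel _ _⟩
    have := LinearMap.congr_fun hs (pres.g x)
    rw [LinearMap.comp_apply, LinearMap.id_apply] at this
    rw [LinearMap.mem_ker, map_sub, this, sub_self]
  refine LinearMap.ext fun x => ?_
  obtain ⟨y, hy⟩ : pres.f x ∈ LinearMap.range s := h ▸ Submodule.mem_top
  have h1 : pres.g (pres.f x) = 0 := by
    rw [← LinearMap.mem_ker, ← pres.exact]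
    exact LinearMap.mem_range_self _ x
  have h2 := LinearMap.congr_fun hs y
  rw [LinearMap.comp_apply, hy, h1, LinearMap.id_apply] at h2
  rw [← hy, ← h2, map_zero]
  rfl

/-- If `Hom(f, C) = 0` for a faithful module `C`, then the differential `f` vanishes. -/
lemma f_eq_zero_of_homC_eq_zero (hC : Function.Injective (LinearMap.lsmul R C))
    (h : LinearMap.range (pres.homC C) = ⊥) : pres.f = 0 := by
  have := pres.proj₀
  refine LinearMap.ext fun x => (Module.forall_dual_apply_eq_zero_iff R _).1 fun φ => hC ?_
  refine LinearMap.ext fun c => ?_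
  have h1 := LinearMap.congr_fun (LinearMap.congr_fun (LinearMap.range_eq_bot.1 h)
    ((LinearMap.toSpanSingleton R C c) ∘ₗ φ)) x
  rw [map_zero]
  exact h1

lemma projective_of_f_eq_zero (h : pres.f = 0) : Module.Projective R X := by
  have := pres.proj₀
  have hk : LinearMap.ker pres.g = ⊥ := by rw [← pres.exact, h, LinearMap.range_zero]
  exact Module.Projective.of_equiv
    (LinearEquiv.ofBijective pres.g ⟨LinearMap.ker_eq_bot.1 hk, pres.surj⟩)

end Presentation

lemma subsingleton_of_horizontallyLinked (C M : Type u) [AddCommGroup C] [Module R C]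
    [AddCommGroup M] [Module R M] (hC : Function.Injective (LinearMap.lsmul R C))
    (hlink : Paper.IsHorizontallyLinked R C M) (N : Type u) [AddCommGroup N] [Module R N]
    (hN : Paper.IsLambdaOf R C M N) [Subsingleton N] : Subsingleton M := by
  obtain ⟨pres, ⟨e⟩⟩ := hN
  obtain ⟨N', ⟨pres₁, ⟨e₁⟩⟩, ⟨pres₂, ⟨e₂⟩⟩⟩ := hlink
  have h : LinearMap.range (pres.homC C) = ⊥ :=
    (Submodule.subsingleton_iff_eq_bot).1 e.symm.injective.subsingleton
  have := projective_of_f_eq_zero pres (f_eq_zero_of_homC_eq_zero C pres hC h)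
  have h₁ := range_homC_eq_bot_of_f_eq_zero C pres₁ (f_eq_zero_of_projective pres₁)
  have := Submodule.subsingleton_iff_eq_bot.2 h₁
  have : Subsingleton N' := e₁.injective.subsingleton
  have h₂ := range_homC_eq_bot_of_f_eq_zero C pres₂ (f_eq_zero_of_subsingleton pres₂)
  have := Submodule.subsingleton_iff_eq_bot.2 h₂
  exact e₂.injective.subsingleton

variable [IsNoetherianRing R] [IsLocalRing R]

local notation "𝔪" => maximalIdeal R

omit [IsNoetherianRing R] in
lemma ext_residue_of_ldepth (Y : Type u) [AddCommGroup Y] [Module R Y] (d : ℕ)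
    (h : Paper.ldepth R Y = d) : ∀ i < d, Subsingleton (E R (R ⧸ 𝔪) Y i) := by
  intro i hi
  by_contra hn
  rw [not_subsingleton_iff_nontrivial] at hn
  have h1 : Paper.ldepth R Y ≤ i :=
    sInf_le ⟨i, rfl, (extGrpEquiv (R ⧸ 𝔪) Y i).toEquiv.nontrivial⟩
  rw [h] at h1
  exact absurd (by exact_mod_cast h1) (not_le.2 hi)

/-- A nonzero module embedded in `Hom(P, C)` has full dimension. -/
lemma moduleDim_eq_of_equiv_range (d : ℕ) (hdim : ringKrullDim R = d) (C : Type u) [AddCommGroup C]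
    [Module R C] [Module.Finite R C] (hC : ∀ i < d, Subsingleton (E R (R ⧸ 𝔪) C i)) {X : Type u}
    [AddCommGroup X] [Module R X] (pres : Paper.MinPres R X) {N : Type u} [AddCommGroup N]
    [Module R N] (e : N ≃ₗ[R] LinearMap.range (pres.homC C)) [Nontrivial N] :
    Paper.moduleDim R N = d := by
  have := pres.finite₁
  have := pres.proj₁
  refine le_antisymm ((ringKrullDim_quotient_le _).trans hdim.le) ?_
  obtain ⟨y, hy⟩ := exists_ne (0 : N)
  refine le_ringKrullDim_quotient d (pres.P₁ →ₗ[R] C)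
    (fun i hi => ext_hom_projective pres.P₁ C (R ⧸ 𝔪) i (hC i hi)) _ (e y : pres.P₁ →ₗ[R] C) ?_ ?_
  · intro h
    exact hy (e.map_eq_zero_iff.1 (Subtype.ext h))
  · intro r hr
    rw [← Submodule.coe_smul, ← map_smul, Module.mem_annihilator.1 hr, map_zero]
    rfl

/-- If `C` has finite injective dimension on the punctured spectrum, high `Ext` modules into `C`
vanish there. -/
lemma exists_smul_ext_eq_zero_of_punctured (d : ℕ) (hd : 0 < d) (hdim : ringKrullDim R = d)
    (C : Type u) [AddCommGroup C] [Module R C] [Module.Finite R C]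
    (hid : ∀ (p : Ideal R) (_ : p.IsPrime), p ≠ 𝔪 →
      Paper.HasFiniteInjDim (Localization.AtPrime p) (LocalizedModule p.primeCompl C))
    (q : Ideal R) (hq : q.IsPrime) (hne : q ≠ 𝔪) (Z : Type u) [AddCommGroup Z] [Module R Z]
    [Module.Finite R Z] (i : ℕ) (hi : d ≤ i + 1) (w : E R Z C (i + 1)) : ∃ t ∉ q, t • w = 0 := by
  obtain ⟨h, rfl⟩ := Nat.exists_eq_succ_of_ne_zero hd.ne'
  have hlt : q < 𝔪 := lt_of_le_of_ne (le_maximalIdeal hq.ne_top) hne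
  have hq' : ringKrullDim (Localization.AtPrime q) ≤ h := by
    rw [IsLocalization.AtPrime.ringKrullDim_eq_height q]
    have h1 := Ideal.height_strict_mono_of_isPrime_of_isPrime hlt
    have h2 := maximalIdeal_height_eq_ringKrullDim (R := R)
    rw [hdim] at h2
    have h3 : (𝔪).height = ((h + 1 : ℕ) : ℕ∞) := by exact_mod_cast h2
    rw [h3] at h1
    have h4 : q.height ≤ (h : ℕ∞) := by
      rw [Nat.cast_succ] at h1
      exact Order.lt_add_one_iff_of_not_isMax (by simp) |>.1 h1
    exact_mod_cast h4
  exact exists_smul_ext_eq_zero q.primeCompl C i Z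
    (ext_subsingleton_of_finite_injDim _ (hid q hq hne) h hq' (i + 1) (by omega) _) w

end Main

end LocalCoh

open LocalCoh ModExt IsLocalRing in
open Paper in
/-- Theorem 4.11: for a generalized Cohen-Macaulay `M ∈ B_C`
horizontally linked with respect to a semidualizing `C` which is locally of finite
injective dimension on the punctured spectrum,
`Ext^i_R(Hom_R(C,M), C) ≅ H^i_m(λ_R(C,M))` for `0 < i < d`; in particular
`λ_R(C,M)` is generalized Cohen-Macaulay. -/
theorem stmt_16 (R : Type u) [CommRing R] [IsNoetherianRing R] [IsLocalRing R]
    (d : ℕ) (hd : 1 < d) (hdim : ringKrullDim R = d)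
    (hCM : (ldepth R R : WithBot ℕ∞) = ringKrullDim R)
    (C : Type u) [AddCommGroup C] [Module R C] (hC : IsSemidualizing R C)
    (hid : ∀ (p : Ideal R) (_ : p.IsPrime), p ≠ IsLocalRing.maximalIdeal R →
      HasFiniteInjDim (Localization.AtPrime p) (LocalizedModule p.primeCompl C))
    (M : Type u) [AddCommGroup M] [Module R M] [Module.Finite R M]
    (hgcm : IsGeneralizedCM R M)
    (hB : MemBass R C M) (hlink : IsHorizontallyLinked R C M) :
    ∀ (N : Type u) [AddCommGroup N] [Module R N], IsLambdaOf R C M N →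
      (∀ i : ℕ, 0 < i → i < d →
        Nonempty (ExtGrp R (C →ₗ[R] M) C i ≃ₗ[R]
          LocCoh R (IsLocalRing.maximalIdeal R) i N)) ∧
      IsGeneralizedCM R N := by
  intro N _ _ hN
  obtain ⟨hfin, hbij, hext⟩ := hC
  obtain ⟨pres, ⟨e⟩⟩ := id hN
  obtain ⟨N', -, ⟨pres', ⟨e'⟩⟩⟩ := id hlink
  have hR := ext_residue_of_ldepth R d (by rw [hdim] at hCM; exact_mod_cast hCM)
  have hkC := ext_residue_semidualizing C hbij
    (fun j =>
      have := hext _ j.succ_pos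
      (extGrpEquiv C C (j + 1)).symm.injective.subsingleton) d hR
  have hHC : ∀ i < d, Subsingleton (LocCoh R (maximalIdeal R) i C) :=
    fun i hi => locCoh_subsingleton i (hkC i hi)
  have hM : Nontrivial M := by
    by_contra h
    rw [not_nontrivial_iff_subsingleton] at h
    have h1 := hgcm.1
    rw [moduleDim, Module.annihilator_eq_top_iff.2 h, ringKrullDim_eq_bot_of_subsingleton] at h1
    simp at h1
  have hNn : Nontrivial N := by
    by_contra h
    rw [not_nontrivial_iff_subsingleton] at h
    exact not_subsingleton M (subsingleton_of_horizontallyLinked C M hbij.1 hlink N hN)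
  have hdM := moduleDim_eq_of_equiv_range d hdim C hkC pres' e'
  have hdN := moduleDim_eq_of_equiv_range d hdim C hkC pres e
  have hX : ∀ j < d, Bdd (maximalIdeal R) (LocCoh R (maximalIdeal R) j (C →ₗ[R] M)) := fun j hj =>
    bdd_locCoh_hom _ M j C
      (fun i hi => bdd_of_isFiniteLength (hgcm.2 i (by
        rw [hdM]; exact_mod_cast hi.trans_lt hj)))
      (fun i =>
        have := hB.2.2 _ i.succ_pos
        (extGrpEquiv C M (i + 1)).symm.injective.subsingleton)
  have hXC : ∀ i, Bdd (maximalIdeal R) (E R (C →ₗ[R] M) C (i + 1)) := fun i =>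
    bdd_ext_of_bdd_locCoh C d
      (fun q hq hne Z _ _ _ i hi w =>
        exists_smul_ext_eq_zero_of_punctured d (by omega) hdim C hid q hq hne Z i hi w)
      d (C →ₗ[R] M) hX i (by omega)
  have := pres.finite₀
  have := pres.proj₀
  have hiso : ∀ i : ℕ, i + 1 < d →
      Nonempty (E R (C →ₗ[R] M) C (i + 1) ≃ₗ[R] LocCoh R (maximalIdeal R) (i + 1) N) := fun i hi => by
    obtain ⟨e₁⟩ := exists_locCoh_range_equiv C (maximalIdeal R) d hHC i (C →ₗ[R] M) pres.P₀ pres.g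
      (SES_of_surjective _ pres.surj) hXC hi
    exact ⟨e₁.trans (Hequiv _ _ ((rangeHomCEquiv C pres).trans e.symm))⟩
  refine ⟨fun i h0 hi => ?_, ?_, fun i hi => ?_⟩
  · obtain ⟨i, rfl⟩ := Nat.exists_eq_succ_of_ne_zero h0.ne'
    obtain ⟨e₁⟩ := hiso i hi
    exact ⟨(extGrpEquiv _ _ _).trans e₁⟩
  · rw [hdN]
    exact_mod_cast hd.le
  · rw [hdN] at hi
    have hi : i < d := by exact_mod_cast hi
    cases i with
    | zero =>
      have h1 := locCoh_range_subsingleton C (maximalIdeal R) (hHC 0 hi)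
        (ι := (LinearMap.ker pres.g).subtype)
      have h2 := (Hequiv (maximalIdeal R) 0 (e.trans (rangeHomCEquiv C pres).symm)).injective.subsingleton
      exact .of_subsingleton
    | succ i =>
      obtain ⟨e₁⟩ := hiso i hi
      exact e₁.isFiniteLength (hXC i).isFiniteLength
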